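/- arXiv:2502.03112 — 2 statements merged into one kernel-verified Lean document; each statement's English description precedes it below -/
import Mathlib

section
/- Let ℓ, m be positive integers. If A ⊆ ℕ has lower density d_(A) > 1 − 1/(2(ℓ+m)), then there exists an infinite set B ⊆ ℕ such that {m·b₁ + ℓ·b₂ : b₁, b₂ ∈ B and b₁ ≤ b₂} ⊆ A. -/
open Filter MeasureTheory Topology

open scoped Classical in
/-- Upper Banach density: `limsup` over window length `N` of the maximal count of
elements of `A` in a window of length `N`, divided by `N`. -/
noncomputable def upperBanachDensity (A : Set ℕ) : ℝ :=
  Filter.limsup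
    (fun N : ℕ => ⨆ M : ℕ, (((Finset.Ico M (M + N)).filter (· ∈ A)).card : ℝ) / N)
    Filter.atTop

open scoped Classical in
/-- Natural upper density of a set of naturals. -/
noncomputable def upperDensity (A : Set ℕ) : ℝ :=
  Filter.limsup (fun N : ℕ => (((Finset.Icc 1 N).filter (· ∈ A)).card : ℝ) / N)
    Filter.atTop

open scoped Classical in
/-- Natural lower density of a set of naturals. -/
noncomputable def lowerDensity (A : Set ℕ) : ℝ :=
  Filter.liminf (fun N : ℕ => (((Finset.Icc 1 N).filter (· ∈ A)).card : ℝ) / N)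
    Filter.atTop

open Filter Topology

/-- bounded functions -/
def Bdd (f : ℤ → ℝ) : Prop := ∃ C, ∀ x, |f x| ≤ C

abbrev Fn := (ℤ → ℝ) →ₗ[ℝ] ℝ

theorem Bdd.of01 {f : ℤ → ℝ} (h0 : ∀ x, 0 ≤ f x) (h1 : ∀ x, f x ≤ 1) : Bdd f :=
  ⟨1, fun x => by rw [abs_of_nonneg (h0 x)]; exact h1 x⟩

theorem Bdd.const (a : ℝ) : Bdd (fun _ => a) := ⟨|a|, fun _ => le_rfl⟩

theorem Bdd.add {f g : ℤ → ℝ} (hf : Bdd f) (hg : Bdd g) : Bdd (fun x => f x + g x) := by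
  obtain ⟨C, hC⟩ := hf
  obtain ⟨D, hD⟩ := hg
  exact ⟨C + D, fun x => (abs_add_le _ _).trans (add_le_add (hC x) (hD x))⟩

theorem Bdd.mul {f g : ℤ → ℝ} (hf : Bdd f) (hg : Bdd g) : Bdd (fun x => f x * g x) := by
  obtain ⟨C, hC⟩ := hf
  obtain ⟨D, hD⟩ := hg
  refine ⟨C * D, fun x => ?_⟩
  rw [abs_mul]
  exact mul_le_mul (hC x) (hD x) (abs_nonneg _) ((abs_nonneg _).trans (hC x))

theorem Bdd.cmul {f : ℤ → ℝ} (a : ℝ) (hf : Bdd f) : Bdd (fun x => a * f x) :=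
  (Bdd.const a).mul hf

theorem Bdd.sub {f g : ℤ → ℝ} (hf : Bdd f) (hg : Bdd g) : Bdd (fun x => f x - g x) := by
  have := hf.add (hg.cmul (-1))
  convert this using 2
  ring

theorem Bdd.sq {f : ℤ → ℝ} (hf : Bdd f) : Bdd (fun x => f x ^ 2) := by
  have := hf.mul hf
  convert this using 2
  ring

theorem Bdd.sum {ι : Type*} (s : Finset ι) {f : ι → ℤ → ℝ} (hf : ∀ i ∈ s, Bdd (f i)) :
    Bdd (fun x => ∑ i ∈ s, f i x) := by
  classical
  induction s using Finset.induction_on with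
  | empty => simpa using Bdd.const 0
  | insert a s ha ih =>
    simp only [Finset.sum_insert ha]
    exact (hf a (by simp)).add (ih fun i hi => hf i (by simp [hi]))

theorem Bdd.shift {f : ℤ → ℝ} (hf : Bdd f) (t : ℤ) : Bdd (fun x => f (x + t)) := by
  obtain ⟨C, hC⟩ := hf
  exact ⟨C, fun x => hC _⟩

theorem Bdd.shift' {f : ℤ → ℝ} (hf : Bdd f) (t : ℤ) : Bdd (fun x => f (x - t)) := by
  obtain ⟨C, hC⟩ := hf
  exact ⟨C, fun x => hC _⟩

theorem Fn.add (φ : Fn) (f g : ℤ → ℝ) : φ (fun x => f x + g x) = φ f + φ g := map_add φ f g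

theorem Fn.sub (φ : Fn) (f g : ℤ → ℝ) : φ (fun x => f x - g x) = φ f - φ g := map_sub φ f g

theorem Fn.cmul (φ : Fn) (a : ℝ) (f : ℤ → ℝ) : φ (fun x => a * f x) = a * φ f :=
  map_smul φ a f

theorem Fn.sum (φ : Fn) {ι : Type*} (s : Finset ι) (f : ι → ℤ → ℝ) :
    φ (fun x => ∑ i ∈ s, f i x) = ∑ i ∈ s, φ (f i) := by
  rw [← map_sum]
  congr 1
  ext x
  simp

theorem Fn.const (φ : Fn) (a : ℝ) : φ (fun _ => a) = a * φ (fun _ => 1) := by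
  rw [← Fn.cmul]; simp

/-- positive functionals -/
def IsPos (φ : Fn) : Prop := ∀ f, Bdd f → (∀ x, 0 ≤ f x) → 0 ≤ φ f

theorem IsPos.mono {φ : Fn} (h : IsPos φ) {f g : ℤ → ℝ} (hf : Bdd f) (hg : Bdd g)
    (hfg : ∀ x, f x ≤ g x) : φ f ≤ φ g := by
  have := h (fun x => g x - f x) (hg.sub hf) (fun x => by linarith [hfg x])
  rw [Fn.sub] at this
  linarith

/-- domination -/
def Dom (ω φ : Fn) : Prop := ∀ f, Bdd f → (∀ x, 0 ≤ f x) → ω f ≤ φ f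

structure IsMean (φ : Fn) : Prop where
  pos : IsPos φ
  one : φ (fun _ => 1) = 1
  inv : ∀ f, Bdd f → ∀ t : ℤ, φ (fun x => f (x + t)) = φ f

theorem IsMean.cst {φ : Fn} (h : IsMean φ) (a : ℝ) : φ (fun _ => a) = a := by
  rw [Fn.const, h.one, mul_one]

theorem IsMean.inv' {φ : Fn} (h : IsMean φ) {f} (hf : Bdd f) (t : ℤ) :
    φ (fun x => f (x - t)) = φ f := h.inv f hf (-t)

theorem IsMean.le_one {φ : Fn} (h : IsMean φ) {f : ℤ → ℝ} (hf : Bdd f) (a : ℝ)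
    (h1 : ∀ x, f x ≤ a) : φ f ≤ a := by
  rw [← h.cst a]
  exact h.pos.mono hf (Bdd.const _) h1

theorem IsPos.bdd {φ : Fn} (h : IsPos φ) {f : ℤ → ℝ} {C : ℝ} (hf : ∀ x, |f x| ≤ C) :
    |φ f| ≤ C * φ (fun _ => 1) := by
  have hb : Bdd f := ⟨C, hf⟩
  rw [abs_le, ← Fn.const, neg_le, ← map_neg]
  constructor
  · exact h.mono (show Bdd (fun x => -f x) by simpa using hb.cmul (-1)) (Bdd.const _) (fun x => by
      have := (abs_le.1 (hf x)).1
      simp only [Pi.neg_apply]; linarith)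
  · exact h.mono hb (Bdd.const _) (fun x => (abs_le.1 (hf x)).2)

theorem IsPos.bdd2 {φ : Fn} (h : IsPos φ) {F : ℤ → ℤ → ℝ} {C : ℝ} (hf : ∀ y x, |F y x| ≤ C) :
    Bdd (fun y => φ (F y)) := ⟨_, fun y => h.bdd (hf y)⟩

/-- indicator -/
noncomputable def ind (X : Set ℤ) : ℤ → ℝ := X.indicator (fun _ => 1)

theorem ind_nonneg (X : Set ℤ) (x : ℤ) : 0 ≤ ind X x :=
  Set.indicator_nonneg (fun _ _ => zero_le_one) x

theorem ind_le_one (X : Set ℤ) (x : ℤ) : ind X x ≤ 1 :=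
  Set.indicator_le_self' (fun _ _ => zero_le_one) x

theorem ind_bdd (X : Set ℤ) : Bdd (ind X) := Bdd.of01 (ind_nonneg X) (ind_le_one X)

theorem ind_mem {X : Set ℤ} {x : ℤ} (h : x ∈ X) : ind X x = 1 := Set.indicator_of_mem h _

theorem ind_not_mem {X : Set ℤ} {x : ℤ} (h : x ∉ X) : ind X x = 0 :=
  Set.indicator_of_notMem h _

theorem ind_compl (X : Set ℤ) (x : ℤ) : ind Xᶜ x = 1 - ind X x := by
  by_cases h : x ∈ X
  · rw [ind_mem h, ind_not_mem (by simpa using h)]; ring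
  · rw [ind_not_mem h, ind_mem (by simpa using h)]; ring

/-- forward averages -/
noncomputable def avg (τ : ℕ) (f : ℤ → ℝ) (x : ℤ) : ℝ := (∑ t ∈ Finset.range τ, f (x + t)) / τ

theorem Bdd.avg {f : ℤ → ℝ} (hf : Bdd f) (τ : ℕ) : Bdd (avg τ f) := by
  have := (Bdd.sum (Finset.range τ) (f := fun t x => f (x + (t:ℤ))) (fun t _ => hf.shift t)).mul
    (Bdd.const ((τ:ℝ)⁻¹))
  exact this

/-- ergodicity -/
def Erg (φ : Fn) : Prop := ∀ f, Bdd f → ∀ ε > 0, ∀ᶠ τ : ℕ in atTop,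
  φ (fun x => (avg τ f x - φ f) ^ 2) ≤ ε

theorem mul_small {φ : Fn} (h : IsMean φ) {g k : ℤ → ℝ} {ε : ℝ} (hε : 0 < ε) (hg : Bdd g)
    (hk0 : ∀ x, 0 ≤ k x) (hk1 : ∀ x, k x ≤ 1) (hs : φ (fun x => g x ^ 2) ≤ ε ^ 2) :
    φ (fun x => g x * k x) ≤ ε := by
  have hk := Bdd.of01 hk0 hk1
  have : φ (fun x => g x * k x) ≤ φ (fun x => (1 / (2 * ε)) * g x ^ 2 + ε / 2) := by
    refine h.pos.mono (hg.mul hk) ((hg.sq.cmul _).add (Bdd.const _)) (fun x => ?_)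
    have h1 : g x * k x ≤ |g x| := by
      calc g x * k x ≤ |g x * k x| := le_abs_self _
        _ = |g x| * k x := by rw [abs_mul, abs_of_nonneg (hk0 x)]
        _ ≤ |g x| := mul_le_of_le_one_right (abs_nonneg _) (hk1 x)
    have h2 : |g x| ≤ (1 / (2 * ε)) * g x ^ 2 + ε / 2 := by
      rw [← sq_abs]
      have h3 : (1 / (2 * ε)) * |g x| ^ 2 + ε / 2 - |g x| = (|g x| - ε) ^ 2 / (2 * ε) := by
        field_simp; ring
      have : 0 ≤ (|g x| - ε) ^ 2 / (2 * ε) := by positivity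
      linarith
    linarith
  rw [Fn.add, Fn.cmul, h.cst] at this
  have h4 : 1 / (2 * ε) * φ (fun x => g x ^ 2) ≤ 1 / (2 * ε) * ε ^ 2 := by gcongr
  have h5 : 1 / (2 * ε) * ε ^ 2 = ε / 2 := by field_simp
  linarith

theorem erg_mul {φ : Fn} (h : IsMean φ) {f k : ℤ → ℝ} {ε : ℝ} (hε : 0 < ε) (hf : Bdd f)
    (hk0 : ∀ x, 0 ≤ k x) (hk1 : ∀ x, k x ≤ 1) (τ : ℕ)
    (hs : φ (fun x => (avg τ f x - φ f) ^ 2) ≤ ε ^ 2) :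
    φ (fun x => avg τ f x * k x) ≤ φ f * φ k + ε := by
  have := mul_small h hε ((hf.avg τ).sub (Bdd.const (φ f))) hk0 hk1 hs
  have h2 : φ (fun x => avg τ f x * k x)
      = φ (fun x => (avg τ f x - φ f) * k x) + φ f * φ k := by
    rw [← Fn.cmul, ← Fn.add]
    congr 1; ext x; ring
  linarith

/-- approximate Riesz representation -/
theorem riesz {φ ω : Fn} (h : IsMean φ) (hω : IsPos ω) (hd : Dom ω φ) {ε : ℝ} (hε : 0 < ε) :
    ∃ f, Bdd f ∧ ∀ k, (∀ x, |k x| ≤ 1) → |ω k - φ (fun x => f x * k x)| ≤ ε := by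
  have hω1 : ω (fun _ => 1) ≤ 1 :=
    (hd (fun _ => 1) (Bdd.const _) (fun _ => zero_le_one)).trans_eq h.one
  set Q : (ℤ → ℝ) → ℝ := fun f => φ (fun x => f x ^ 2) - 2 * ω f with hQ
  let S : Set ℝ := Q '' {f | Bdd f}
  have hlb : ∀ y ∈ S, -1 ≤ y := by
    rintro _ ⟨f, hf, rfl⟩
    have hf : Bdd f := hf
    have h1 := hd (fun x => f x ^ 2) hf.sq (fun x => sq_nonneg _)
    have h2 := hω.mono (f := fun x => -1) (g := fun x => f x ^ 2 - 2 * f x) (Bdd.const _)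
      (hf.sq.sub (hf.cmul 2)) (fun x => by nlinarith [sq_nonneg (f x - 1)])
    rw [Fn.sub, Fn.cmul, Fn.const] at h2
    simp only [hQ]
    linarith
  have hne : S.Nonempty := ⟨_, fun _ => 0, Bdd.const 0, rfl⟩
  obtain ⟨_, ⟨f, hf, rfl⟩, hlt⟩ := exists_lt_of_csInf_lt hne
    (show sInf S < sInf S + ε ^ 2 by linarith [pow_pos hε 2])
  have hf : Bdd f := hf
  refine ⟨f, hf, fun k hk => ?_⟩
  have hkb : Bdd k := ⟨1, hk⟩
  have key : ∀ y : ℝ, Q f - ε ^ 2 ≤ Q (fun x => f x + y * k x) := by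
    intro y
    have : sInf S ≤ Q (fun x => f x + y * k x) :=
      csInf_le ⟨-1, hlb⟩ ⟨_, hf.add (hkb.cmul y), rfl⟩
    linarith
  have hexp : ∀ y : ℝ, Q (fun x => f x + y * k x) =
      Q f + 2 * y * (φ (fun x => f x * k x) - ω k) + y ^ 2 * φ (fun x => k x ^ 2) := by
    intro y
    have e1 : φ (fun x => (f x + y * k x) ^ 2) =
        φ (fun x => f x ^ 2) + 2 * y * φ (fun x => f x * k x) + y ^ 2 * φ (fun x => k x ^ 2) := by
      rw [← Fn.cmul, ← Fn.cmul, ← Fn.add, ← Fn.add]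
      congr 1; ext x; ring
    simp only [hQ]
    rw [e1, Fn.add, Fn.cmul]
    ring
  have hk2 : φ (fun x => k x ^ 2) ≤ 1 := h.le_one hkb.sq 1 (fun x => by
    rw [← sq_abs]; exact pow_le_one₀ (abs_nonneg _) (hk x))
  have a1 := key ε
  have a2 := key (-ε)
  rw [hexp] at a1 a2
  rw [abs_le]
  constructor <;> nlinarith

structure Ker (κ : ℤ → ℤ → ℝ) (r : ℝ) : Prop where
  nonneg : ∀ x y, 0 ≤ κ x y
  le_one : ∀ x y, κ x y ≤ 1
  inv : ∀ (t : ℕ) x y, κ (x + t) (y + t) ≤ κ x y + t * r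
  rpos : 0 ≤ r

theorem Ker.bdd {κ r} (h : Ker κ r) (x : ℤ) : Bdd (κ x) := Bdd.of01 (h.nonneg x) (h.le_one x)

theorem Ker.abs {κ r} (h : Ker κ r) (x y : ℤ) : |κ x y| ≤ 1 := by
  rw [abs_of_nonneg (h.nonneg x y)]; exact h.le_one x y

theorem Ker.bdd2 {κ r} (h : Ker κ r) {φ : Fn} (hφ : IsPos φ) (s : ℤ) :
    Bdd (fun x => φ (fun y => κ x (y - s))) := hφ.bdd2 (C := 1) (fun _ _ => h.abs _ _)

/-- total mass of a kernel -/
noncomputable def mass (φ : Fn) (κ : ℤ → ℤ → ℝ) : ℝ := φ (fun x => φ (fun y => κ x y))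

theorem mass_shift {φ κ r} (h : IsMean φ) (hk : Ker κ r) (s : ℤ) :
    φ (fun x => φ (fun y => κ x (y - s))) = mass φ κ := by
  unfold mass
  congr 1; ext x
  exact h.inv' (hk.bdd x) s

open Filter Topology

theorem le_avg_of_le {L : ℝ} {τ : ℕ} (hτ : 0 < τ) {G : ℕ → ℝ} (h : ∀ t < τ, L ≤ G t) :
    L ≤ (∑ t ∈ Finset.range τ, G t) / τ := by
  rw [le_div_iff₀ (by exact_mod_cast hτ)]
  have := Finset.card_nsmul_le_sum (Finset.range τ) G L (fun t ht => h t (Finset.mem_range.1 ht))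
  simp only [Finset.card_range, nsmul_eq_mul] at this
  linarith

theorem avg_le_of_le {L : ℝ} {τ : ℕ} (hτ : 0 < τ) {G : ℕ → ℝ} (h : ∀ t < τ, G t ≤ L) :
    (∑ t ∈ Finset.range τ, G t) / τ ≤ L := by
  rw [div_le_iff₀ (by exact_mod_cast hτ)]
  have := Finset.sum_le_card_nsmul (Finset.range τ) G L (fun t ht => h t (Finset.mem_range.1 ht))
  simp only [Finset.card_range, nsmul_eq_mul] at this
  linarith

theorem Fn.avg_eq (φ : Fn) (τ : ℕ) (F : ℕ → ℤ → ℝ) :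
    φ (fun x => (∑ t ∈ Finset.range τ, F t x) / τ) = (∑ t ∈ Finset.range τ, φ (F t)) / τ := by
  have : (fun x => (∑ t ∈ Finset.range τ, F t x) / τ)
      = fun x => (τ:ℝ)⁻¹ * (∑ t ∈ Finset.range τ, F t x) := by
    ext x; rw [div_eq_inv_mul]
  rw [this, Fn.cmul, Fn.sum, div_eq_inv_mul]

theorem avg_move {φ : Fn} (h : IsMean φ) {f k : ℤ → ℝ} (hf : Bdd f) (hk : Bdd k) (τ : ℕ) (a : ℤ) :
    φ (fun y => f y * ((∑ t ∈ Finset.range τ, k (y - a * t)) / τ))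
      = φ (fun y => ((∑ t ∈ Finset.range τ, f (y + a * t)) / τ) * k y) := by
  have e1 : (fun y => f y * ((∑ t ∈ Finset.range τ, k (y - a * t)) / τ))
      = fun y => (∑ t ∈ Finset.range τ, f y * k (y - a * t)) / τ := by
    ext y; rw [← Finset.mul_sum, mul_div_assoc]
  have e2 : (fun y => ((∑ t ∈ Finset.range τ, f (y + a * t)) / τ) * k y)
      = fun y => (∑ t ∈ Finset.range τ, f (y + a * t) * k y) / τ := by
    ext y; rw [← Finset.sum_mul]; ring
  rw [e1, e2, Fn.avg_eq, Fn.avg_eq]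
  congr 1
  refine Finset.sum_congr rfl fun t _ => ?_
  rw [← h.inv (fun y => f y * k (y - a * t)) (hf.mul (hk.shift' _)) (a * t)]
  congr 1; ext y; simp

theorem Ker.M_shift {κ r} (hk : Ker κ r) {φ : Fn} (h : IsMean φ) (t : ℕ) (x : ℤ) :
    φ (κ (x + t)) ≤ φ (κ x) + t * r := by
  rw [← h.inv (κ (x + t)) (hk.bdd _) t]
  have := h.pos.mono ((hk.bdd (x + t)).shift t) ((hk.bdd x).add (Bdd.const (t * r)))
    (fun y => hk.inv t x y)
  rwa [Fn.add, h.cst] at this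

theorem Ker.M_nonneg {κ r} (hk : Ker κ r) {φ : Fn} (h : IsMean φ) (x : ℤ) : 0 ≤ φ (κ x) :=
  h.pos _ (hk.bdd x) (hk.nonneg x)

theorem Ker.M_le {κ r} (hk : Ker κ r) {φ : Fn} (h : IsMean φ) (x : ℤ) : φ (κ x) ≤ 1 :=
  h.le_one (hk.bdd x) 1 (hk.le_one x)

theorem Ker.M_bdd {κ r} (hk : Ker κ r) {φ : Fn} (h : IsMean φ) : Bdd (fun x => φ (κ x)) :=
  Bdd.of01 (hk.M_nonneg h) (hk.M_le h)

/-- moving averages onto a `[0,1]`-valued weight -/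
theorem weight_avg {κ r} (hk : Ker κ r) {φ : Fn} (h : IsMean φ) {w : ℤ → ℝ}
    (hw0 : ∀ x, 0 ≤ w x) (hw1 : ∀ x, w x ≤ 1) (s : ℤ) {τ : ℕ} (hτ : 0 < τ) :
    φ (fun x => w (x + s) * φ (κ x)) ≤ φ (fun x => avg τ w x * φ (κ (x - s))) + τ * r := by
  have hw := Bdd.of01 hw0 hw1
  have hM := hk.M_bdd h
  have e : φ (fun x => avg τ w x * φ (κ (x - s)))
      = (∑ t ∈ Finset.range τ, φ (fun x => w (x + s + t) * φ (κ x))) / τ := by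
    rw [← Fn.avg_eq, ← h.inv (fun x => avg τ w x * φ (κ (x - s)))
      ((hw.avg τ).mul (hM.shift' s)) s]
    congr 1; ext x
    simp only [avg, add_sub_cancel_right]
    rw [← Finset.sum_mul]; ring
  rw [e, ← sub_le_iff_le_add]
  refine le_avg_of_le hτ (fun t ht => ?_)
  rw [sub_le_iff_le_add, ← h.inv (fun x => w (x + s) * φ (κ x)) ((hw.shift s).mul hM) t]
  have := h.pos.mono (((hw.shift s).mul hM).shift t)
    (((hw.shift (s + t)).mul hM).add (Bdd.const (τ * r))) (fun x => ?_)
  · rw [Fn.add, h.cst] at this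
    simpa only [← add_assoc] using this
  · have h1 := hk.M_shift h t x
    have h2 : x + t + s = x + (s + t) := by ring
    rw [h2]
    have h3 : (t:ℝ) * r ≤ τ * r := by have := hk.rpos; gcongr
    have h4 : w (x + (s + t)) * φ (κ (x + t)) ≤ w (x + (s + t)) * (φ (κ x) + τ * r) :=
      mul_le_mul_of_nonneg_left (by linarith) (hw0 _)
    have h5 : w (x + (s + t)) * (τ * r) ≤ τ * r :=
      mul_le_of_le_one_left (by have := hk.rpos; positivity) (hw1 _)
    linarith

theorem T1z {φ : Fn} (h : IsMean φ) (he : Erg φ) (Z : Set ℤ) {ε : ℝ} (hε : 0 < ε) :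
    ∃ τ : ℕ, ∀ κ r, Ker κ r → ∀ s : ℤ,
      φ (fun x => ind Z (x + s) * φ (κ x)) ≤ φ (ind Z) * mass φ κ + ε + τ * r := by
  obtain ⟨τ, h1, hτ⟩ := ((he _ (ind_bdd Z) _ (pow_pos hε 2)).and (eventually_gt_atTop 0)).exists
  refine ⟨τ, fun κ r hk s => ?_⟩
  have a := weight_avg hk h (ind_nonneg Z) (ind_le_one Z) s hτ
  have b := erg_mul h hε (ind_bdd Z) (k := fun x => φ (κ (x - s))) (fun x => hk.M_nonneg h _)
    (fun x => hk.M_le h _) τ h1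
  rw [h.inv' (hk.M_bdd h) s] at b
  unfold mass
  linarith

theorem T2 {φ ω : Fn} (h : IsMean φ) (he : Erg φ) (hω : IsPos ω) (hd : Dom ω φ)
    {ε : ℝ} (hε : 0 < ε) :
    ∃ τ : ℕ, ∀ κ r, Ker κ r → ∀ s : ℤ,
      φ (fun x => ω (fun y => κ x (y - s))) ≤ ω (fun _ => 1) * mass φ κ + ε + τ * r := by
  have hω1 : ω (fun _ => 1) ≤ 1 :=
    (hd (fun _ => 1) (Bdd.const _) (fun _ => zero_le_one)).trans_eq h.one
  have hω0 : 0 ≤ ω (fun _ => 1) := hω _ (Bdd.const _) (fun _ => zero_le_one)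
  obtain ⟨f, hf, hfk⟩ := riesz h hω hd (show 0 < ε / 4 by linarith)
  have hφf : φ f ≤ ω (fun _ => 1) + ε / 4 := by
    have := hfk (fun _ => 1) (fun _ => by simp)
    simp only [mul_one] at this
    linarith [(abs_le.1 this).1]
  obtain ⟨τ, h1, hτ⟩ := ((he _ hf ((ε / 4) ^ 2) (by positivity)).and
    (eventually_gt_atTop 0)).exists
  refine ⟨τ, fun κ r hk s => ?_⟩
  have hr := hk.rpos
  -- averaged kernel
  set K : ℤ → ℤ → ℝ := fun x y => (∑ t ∈ Finset.range τ, κ x (y - t - s)) / τ with hK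
  have hK0 : ∀ x y, 0 ≤ K x y := fun x y =>
    div_nonneg (Finset.sum_nonneg fun _ _ => hk.nonneg _ _) (Nat.cast_nonneg _)
  have hK1 : ∀ x y, K x y ≤ 1 := fun x y => avg_le_of_le hτ (fun t _ => hk.le_one _ _)
  have hKa : ∀ x y, |K x y| ≤ 1 := fun x y => by rw [abs_of_nonneg (hK0 x y)]; exact hK1 x y
  have s1 : φ (fun x => ω (fun y => κ x (y - s))) ≤ φ (fun x => ω (K x)) + τ * r := by
    have e : φ (fun x => ω (K x))
        = (∑ t ∈ Finset.range τ, φ (fun x => ω (fun y => κ x (y - t - s)))) / τ := by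
      rw [← Fn.avg_eq]
      congr 1; ext x
      rw [hK, Fn.avg_eq]
    rw [e, ← sub_le_iff_le_add]
    refine le_avg_of_le hτ (fun t ht => ?_)
    have hb := hk.bdd2 hω s
    rw [sub_le_iff_le_add, ← h.inv _ hb t]
    have hb2 : Bdd (fun x => ω (fun y => κ x (y - t - s))) :=
      hω.bdd2 (C := 1) (fun _ _ => hk.abs _ _)
    have := h.pos.mono (hb.shift t) (hb2.add (Bdd.const (τ * r))) (fun x => ?_)
    · rwa [Fn.add, h.cst] at this
    · have hm := hω.mono (((hk.bdd (x + t)).shift' s))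
        ((((hk.bdd x).shift' s).shift' t).add (Bdd.const (t * r)))
        (fun y => by
          have := hk.inv t x (y - t - s)
          have e : y - t - s + t = y - s := by ring
          rwa [e] at this)
      rw [Fn.add, Fn.const] at hm
      have h3 : (t:ℝ) * r * ω (fun _ => 1) ≤ τ * r := by
        calc (t:ℝ) * r * ω (fun _ => 1) ≤ t * r :=
              mul_le_of_le_one_right (by positivity) hω1
          _ ≤ τ * r := by gcongr
      linarith
  have s2 : ∀ x, ω (K x) ≤ ω (fun _ => 1) * φ (fun y => κ x (y - s)) + 3 * ε / 4 := by
    intro x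
    have a := (abs_le.1 (hfk (K x) (hKa x))).2
    have b := avg_move h hf ((hk.bdd x).shift' s) τ 1
    have c := erg_mul h (show 0 < ε / 4 by linarith) hf (k := fun y => κ x (y - s))
      (fun y => hk.nonneg _ _) (fun y => hk.le_one _ _) τ h1
    simp only [one_mul] at b
    have d0 : 0 ≤ φ (fun y => κ x (y - s)) :=
      h.pos _ ((hk.bdd x).shift' s) (fun y => hk.nonneg _ _)
    have d1 : φ (fun y => κ x (y - s)) ≤ 1 :=
      h.le_one ((hk.bdd x).shift' s) 1 (fun y => hk.le_one _ _)
    have e : φ (fun y => f y * K x y) = φ (fun y => avg τ f y * κ x (y - s)) := b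
    nlinarith
  have s3 : φ (fun x => ω (K x)) ≤ ω (fun _ => 1) * mass φ κ + 3 * ε / 4 := by
    have := h.pos.mono (hω.bdd2 (C := 1) hKa)
      (((hk.bdd2 h.pos s).cmul (ω fun _ => 1)).add (Bdd.const (3 * ε / 4))) s2
    rwa [Fn.add, h.cst, Fn.cmul, mass_shift h hk] at this
  linarith

/-- fibres of a set under `(c, b) ↦ m c + ℓ b` -/
def fib (m ℓ : ℕ) (T : Set ℤ) (c : ℤ) : Set ℤ := {b | m * c + ℓ * b ∈ T}

theorem ind_fib_shift (m ℓ : ℕ) (T : Set ℤ) (c k b : ℤ) :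
    ind (fib m ℓ T (c + ℓ * k)) b = ind (fib m ℓ T c) (b + m * k) := by
  have : b ∈ fib m ℓ T (c + ℓ * k) ↔ b + m * k ∈ fib m ℓ T c := by
    simp only [fib, Set.mem_setOf_eq]
    rw [show (m:ℤ) * (c + ℓ * k) + ℓ * b = m * c + ℓ * (b + m * k) by ring]
  by_cases hb : b ∈ fib m ℓ T (c + ℓ * k)
  · rw [ind_mem hb, ind_mem (this.1 hb)]
  · rw [ind_not_mem hb, ind_not_mem (fun h => hb (this.2 h))]

theorem fib_mean_periodic {φ : Fn} (h : IsMean φ) (m ℓ : ℕ) (T : Set ℤ) (c k : ℤ) :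
    φ (ind (fib m ℓ T (c + ℓ * k))) = φ (ind (fib m ℓ T c)) := by
  rw [← h.inv (ind (fib m ℓ T c)) (ind_bdd _) (m * k)]
  congr 1; ext b; exact ind_fib_shift _ _ _ _ _ _

theorem erg_fib {φ : Fn} (h : IsMean φ) (he : Erg φ) (m ℓ : ℕ) (hℓ : 0 < ℓ) (T : Set ℤ)
    {ε : ℝ} (hε : 0 < ε) : ∀ᶠ τ : ℕ in atTop, ∀ c : ℤ,
      φ (fun x => (avg τ (ind (fib m ℓ T c)) x - φ (ind (fib m ℓ T c))) ^ 2) ≤ ε := by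
  have h1 : ∀ᶠ τ : ℕ in atTop, ∀ j ∈ Finset.range ℓ,
      φ (fun x => (avg τ (ind (fib m ℓ T j)) x - φ (ind (fib m ℓ T j))) ^ 2) ≤ ε := by
    rw [eventually_all_finset]
    exact fun j _ => he _ (ind_bdd _) ε hε
  filter_upwards [h1] with τ hτ c
  have hl : (0:ℤ) < ℓ := by exact_mod_cast hℓ
  obtain ⟨j, hj⟩ : ∃ j : ℕ, (j:ℤ) = c % ℓ := ⟨(c % ℓ).toNat, by
    rw [Int.toNat_of_nonneg (Int.emod_nonneg _ hl.ne')]⟩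
  have hjl : j < ℓ := by have := Int.emod_lt_of_pos c hl; omega
  have hc : c = j + ℓ * (c / ℓ) := by rw [hj]; exact (Int.emod_add_mul_ediv c ℓ).symm
  have := hτ j (Finset.mem_range.2 hjl)
  rw [hc, fib_mean_periodic h]
  rw [← h.inv _ (((ind_bdd _).avg τ).sub (Bdd.const _)).sq (m * (c / ℓ))] at this
  refine le_of_eq_of_le ?_ this
  congr 1; ext x
  congr 2
  simp only [avg]
  congr 1
  refine Finset.sum_congr rfl fun t _ => ?_
  rw [ind_fib_shift]
  congr 1; ring

theorem sum_mul_le {M τ : ℕ} (hM : 0 < M) {x : ℕ → ℝ} (hx : ∀ t, 0 ≤ x t) :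
    ∑ t ∈ Finset.range τ, x (M * t) ≤ ∑ t ∈ Finset.range (M * τ), x t := by
  have hinj : Set.InjOn (fun t => M * t) (Finset.range τ : Set ℕ) :=
    fun a _ b _ hab => Nat.eq_of_mul_eq_mul_left hM hab
  rw [← Finset.sum_image (f := x) hinj]
  refine Finset.sum_le_sum_of_subset_of_nonneg ?_ (fun _ _ _ => hx _)
  intro t ht
  obtain ⟨u, hu, rfl⟩ := Finset.mem_image.1 ht
  exact Finset.mem_range.2 (Nat.mul_lt_mul_of_pos_left (Finset.mem_range.1 hu) hM)

theorem T3 {φ : Fn} (h : IsMean φ) (he : Erg φ) (m ℓ : ℕ) (hℓ : 0 < ℓ) (T : Set ℤ)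
    {ε : ℝ} (hε : 0 < ε) :
    ∃ τ : ℕ, ∀ κ r, Ker κ r → ∀ s : ℤ,
      φ (fun x => φ (fun y => ind (fib m ℓ T (x + s)) y * κ x (y - s))) ≤
        ((m + ℓ : ℕ):ℝ) * ((∑ j ∈ Finset.range ℓ, φ (ind (fib m ℓ T j))) / ℓ) * mass φ κ
          + ε + τ * r := by
  set M := m + ℓ with hMdef
  have hM : 0 < M := by omega
  have hM' : (0:ℝ) < M := by exact_mod_cast hM
  have hε' : 0 < ε / M := by positivity
  obtain ⟨τ, h1, hτ⟩ : ∃ τ : ℕ, (∀ c : ℤ, φ (fun x => (avg (M * τ) (ind (fib m ℓ T c)) x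
      - φ (ind (fib m ℓ T c))) ^ 2) ≤ (ε / M) ^ 2) ∧ 0 < τ := by
    have := (tendsto_id.const_mul_atTop' hM : Tendsto (fun τ : ℕ => M * τ) atTop atTop)
    exact ((this.eventually (erg_fib h he m ℓ hℓ T (pow_pos hε' 2))).and
      (eventually_gt_atTop 0)).exists
  refine ⟨ℓ * τ + M * ℓ, fun κ r hk s => ?_⟩
  have hr := hk.rpos
  set g : ℤ → ℤ → ℝ := fun c => ind (fib m ℓ T c) with hg
  have hgb : ∀ c, Bdd (g c) := fun c => ind_bdd _
  have hg0 : ∀ c y, 0 ≤ g c y := fun c => ind_nonneg _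
  have hg1 : ∀ c y, g c y ≤ 1 := fun c => ind_le_one _
  have gsh : ∀ c k b, g (c + ℓ * k) b = g c (b + m * k) := ind_fib_shift m ℓ T
  have hab : ∀ (u : ℤ → ℤ) (v w : ℤ → ℤ → ℤ) x y, |g (u x) (w x y) * κ x (v x y)| ≤ 1 :=
    fun u v w x y => by
      rw [abs_of_nonneg (mul_nonneg (hg0 _ _) (hk.nonneg _ _))]
      exact mul_le_one₀ (hg1 _ _) (hk.nonneg _ _) (hk.le_one _ _)
  have s1 : φ (fun x => φ (fun y => g (x + s) y * κ x (y - s))) ≤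
      (∑ t ∈ Finset.range τ, φ (fun x => φ (fun y => g (x + s) y * κ x (y - M * t - s)))) / τ
        + ℓ * τ * r := by
    rw [← sub_le_iff_le_add]
    refine le_avg_of_le hτ (fun t ht => ?_)
    have hb : Bdd (fun x => φ (fun y => g (x + s) y * κ x (y - s))) :=
      h.pos.bdd2 (C := 1) (hab (fun x => x + s) (fun x y => y - s) (fun x y => y))
    have hb2 : Bdd (fun x => φ (fun y => g (x + s) y * κ x (y - M * t - s))) :=
      h.pos.bdd2 (C := 1) (hab (fun x => x + s) (fun x y => y - M * t - s) (fun x y => y))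
    rw [sub_le_iff_le_add, ← h.inv _ hb (ℓ * t)]
    have := h.pos.mono (hb.shift (ℓ * t)) (hb2.add (Bdd.const (ℓ * τ * r))) (fun x => ?_)
    · rwa [Fn.add, h.cst] at this
    · rw [← h.inv' (f := fun y => g (x + ℓ * t + s) y * κ (x + ℓ * t) (y - s))
        ((hgb _).mul ((hk.bdd _).shift' s)) (m * t)]
      have hm := h.pos.mono
        (((hgb (x + ℓ * t + s)).mul ((hk.bdd (x + ℓ * t)).shift' s)).shift' (m * t))
        (((hgb (x + s)).mul (((hk.bdd x).shift' s).shift' (M * t))).add (Bdd.const (ℓ * τ * r)))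
        (fun y => ?_)
      · rwa [Fn.add, h.cst] at hm
      · have e1 : g (x + ℓ * t + s) (y - m * t) = g (x + s) y := by
          rw [show x + ℓ * t + s = x + s + ℓ * t by ring, gsh]; congr 1; ring
        have e2 := hk.inv (ℓ * t) x (y - M * t - s)
        push_cast at e2
        have e3 : y - M * t - s + ℓ * t = y - m * t - s := by rw [hMdef]; push_cast; ring
        rw [e3] at e2
        rw [e1]
        have h3 : (ℓ:ℝ) * t * r ≤ ℓ * τ * r := by gcongr
        have h4 : g (x + s) y * κ (x + ℓ * t) (y - m * t - s) ≤
          g (x + s) y * (κ x (y - M * t - s) + ℓ * τ * r) :=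
          mul_le_mul_of_nonneg_left (by linarith) (hg0 _ _)
        have h5 : g (x + s) y * (ℓ * τ * r) ≤ ℓ * τ * r :=
          mul_le_of_le_one_left (by positivity) (hg1 _ _)
        linarith
  have s2 : ∀ x, (∑ t ∈ Finset.range τ, φ (fun y => g (x + s) y * κ x (y - M * t - s))) / τ ≤
      M * (φ (g (x + s)) * φ (κ x)) + ε := by
    intro x
    have b := avg_move h (hgb (x + s)) ((hk.bdd x).shift' s) τ M
    have e1 : (∑ t ∈ Finset.range τ, φ (fun y => g (x + s) y * κ x (y - M * t - s))) / τ =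
        φ (fun y => g (x + s) y * ((∑ t ∈ Finset.range τ, κ x (y - M * t - s)) / τ)) := by
      rw [← Fn.avg_eq]
      congr 1; ext y; rw [← Finset.mul_sum, mul_div_assoc]
    rw [e1, b]
    have c := erg_mul h hε' (hgb (x + s)) (k := fun y => κ x (y - s))
      (fun y => hk.nonneg _ _) (fun y => hk.le_one _ _) (M * τ) (h1 _)
    rw [h.inv' (hk.bdd x)] at c
    have d : φ (fun y => (∑ t ∈ Finset.range τ, g (x + s) (y + M * t)) / τ * κ x (y - s)) ≤
        φ (fun y => M * (avg (M * τ) (g (x + s)) y * κ x (y - s))) := by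
      have hb1 : Bdd (fun y => (∑ t ∈ Finset.range τ, g (x + s) (y + M * t)) / τ) := by
        refine Bdd.of01 (fun y => ?_) (fun y => ?_)
        · exact div_nonneg (Finset.sum_nonneg fun _ _ => hg0 _ _) (Nat.cast_nonneg _)
        · exact avg_le_of_le hτ (fun t _ => hg1 _ _)
      refine h.pos.mono (hb1.mul ((hk.bdd x).shift' s))
        ((((hgb _).avg _).mul ((hk.bdd x).shift' s)).cmul _) (fun y => ?_)
      rw [← mul_assoc]
      refine mul_le_mul_of_nonneg_right ?_ (hk.nonneg _ _)
      have := sum_mul_le (τ := τ) hM (x := fun t => g (x + s) (y + t)) (fun t => hg0 _ _)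
      push_cast at this
      simp only [avg]
      push_cast
      have hτ' : (0:ℝ) < τ := by exact_mod_cast hτ
      rw [← mul_div_assoc, mul_div_mul_left _ _ hM'.ne']
      gcongr
    rw [Fn.cmul] at d
    have := mul_le_mul_of_nonneg_left c hM'.le
    have e2 : (M:ℝ) * (φ (g (x + s)) * φ (κ x) + ε / M) = M * (φ (g (x + s)) * φ (κ x)) + ε := by
      field_simp
    linarith
  -- final periodic average
  set e : ℤ → ℝ := fun c => φ (g c) with hedef
  have he0 : ∀ c, 0 ≤ e c := fun c => h.pos _ (hgb c) (hg0 c)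
  have he1 : ∀ c, e c ≤ 1 := fun c => h.le_one (hgb c) 1 (hg1 c)
  have s3 : (∑ t ∈ Finset.range τ, φ (fun x => φ (fun y => g (x + s) y * κ x (y - M * t - s)))) / τ
      ≤ M * φ (fun x => e (x + s) * φ (κ x)) + ε := by
    rw [← Fn.avg_eq]
    have hb : ∀ t : ℕ, Bdd (fun x => φ (fun y => g (x + s) y * κ x (y - M * t - s))) := fun t =>
      h.pos.bdd2 (C := 1) (hab (fun x => x + s) (fun x y => y - M * t - s) (fun x y => y))
    have hbs := (Bdd.sum (Finset.range τ) (fun t _ => hb t)).mul (Bdd.const ((τ:ℝ)⁻¹))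
    have := h.pos.mono hbs
      (((((Bdd.of01 he0 he1).shift s).mul (hk.M_bdd h)).cmul M).add (Bdd.const ε))
      (fun x => by simpa [div_eq_mul_inv] using s2 x)
    rw [Fn.add, h.cst, Fn.cmul] at this
    simpa [div_eq_mul_inv] using this
  have s4 : φ (fun x => e (x + s) * φ (κ x)) ≤
      ((∑ j ∈ Finset.range ℓ, φ (ind (fib m ℓ T j))) / ℓ) * mass φ κ + ℓ * r := by
    have a := weight_avg hk h he0 he1 s hℓ
    have hper : ∀ x, e (x + ℓ) = e x := fun x => by
      have := fib_mean_periodic h m ℓ T x 1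
      simpa using this
    have hS : ∀ x : ℤ, ∑ t ∈ Finset.range ℓ, e (x + t) = ∑ t ∈ Finset.range ℓ, e t := by
      have step : ∀ x : ℤ, ∑ t ∈ Finset.range ℓ, e (x + 1 + t) = ∑ t ∈ Finset.range ℓ, e (x + t) := by
        intro x
        have h1 := Finset.sum_range_succ (fun t : ℕ => e (x + t)) ℓ
        have h2 := Finset.sum_range_succ' (fun t : ℕ => e (x + t)) ℓ
        simp only [Nat.cast_add, Nat.cast_one, Nat.cast_zero, add_zero] at h1 h2
        rw [hper] at h1
        have h3 : ∑ t ∈ Finset.range ℓ, e (x + 1 + t) = ∑ t ∈ Finset.range ℓ, e (x + (t + 1)) :=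
          Finset.sum_congr rfl fun t _ => by congr 1; ring
        linarith
      intro x
      induction x using Int.induction_on with
      | zero => simp
      | succ i ih => rw [step, ih]
      | pred i ih =>
        have := step (-i - 1)
        rw [sub_add_cancel] at this
        rw [← this, ih]
    have hav : ∀ x, avg ℓ e x = (∑ j ∈ Finset.range ℓ, φ (ind (fib m ℓ T j))) / ℓ := fun x => by
      simp only [avg, hS]; rfl
    simp only [hav] at a
    rw [Fn.cmul, h.inv' (hk.M_bdd h) s] at a
    exact a
  have s5 := mul_le_mul_of_nonneg_left s4 hM'.le
  push_cast
  have e5 : (M:ℝ) * ((∑ j ∈ Finset.range ℓ, φ (ind (fib m ℓ T j))) / ℓ * mass φ κ + ℓ * r)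
    = M * ((∑ j ∈ Finset.range ℓ, φ (ind (fib m ℓ T j))) / ℓ) * mass φ κ + M * ℓ * r := by ring
  rw [e5] at s5
  change φ (fun x => φ (fun y => g (x + s) y * κ x (y - s))) ≤ _
  linarith

open Filter Topology

theorem bessel {φ : Fn} {d : ℕ} {e : ℕ → ℤ → ℝ} (heb : ∀ j < d, Bdd (e j))
    (heo : ∀ i < d, ∀ j < d, φ (fun x => e i x * e j x) = if i = j then 1 else 0)
    {g : Fn} (hg : ∀ h, Bdd h → (g h) ^ 2 ≤ φ (fun x => h x ^ 2)) :
    ∑ j ∈ Finset.range d, (g (e j)) ^ 2 ≤ 1 := by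
  set S := ∑ j ∈ Finset.range d, (g (e j)) ^ 2 with hS
  have hb : Bdd (fun x => ∑ j ∈ Finset.range d, g (e j) * e j x) :=
    Bdd.sum _ (fun j hj => (heb j (Finset.mem_range.1 hj)).cmul _)
  have h1 : g (fun x => ∑ j ∈ Finset.range d, g (e j) * e j x) = S := by
    rw [Fn.sum]
    refine Finset.sum_congr rfl fun j _ => ?_
    rw [Fn.cmul]; ring
  have h2 : φ (fun x => (∑ j ∈ Finset.range d, g (e j) * e j x) ^ 2) = S := by
    have : (fun x => (∑ j ∈ Finset.range d, g (e j) * e j x) ^ 2) =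
        fun x => ∑ i ∈ Finset.range d, ∑ j ∈ Finset.range d,
          (g (e i) * g (e j)) * (e i x * e j x) := by
      ext x
      rw [sq, Finset.sum_mul_sum]
      refine Finset.sum_congr rfl fun i _ => Finset.sum_congr rfl fun j _ => by ring
    rw [this, Fn.sum]
    refine Finset.sum_congr rfl fun i hi => ?_
    rw [Fn.sum]
    have : ∀ j ∈ Finset.range d, φ (fun x => (g (e i) * g (e j)) * (e i x * e j x)) =
        if i = j then (g (e i)) ^ 2 else 0 := by
      intro j hj
      rw [Fn.cmul, heo i (Finset.mem_range.1 hi) j (Finset.mem_range.1 hj)]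
      split_ifs with hij
      · rw [hij]; ring
      · ring
    rw [Finset.sum_congr rfl this, Finset.sum_ite_eq]
    simp [hi]
  have h3 := hg _ hb
  rw [h1, h2] at h3
  by_contra hlt
  push Not at hlt
  nlinarith

theorem TB {φ : Fn} (hφ : IsMean φ) {q ζ : ℝ} (hq : 0 ≤ q) (hζ : 0 < ζ) :
    ∃ D L : ℕ, ∀ (ι : Type) (s : Finset ι) (w : ι → ℝ) (g : ι → Fn),
      (∀ k ∈ s, 0 ≤ w k) → (∑ k ∈ s, w k ≤ q) →
      (∀ k ∈ s, ∀ h, Bdd h → (g k h) ^ 2 ≤ φ (fun x => h x ^ 2)) →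
      ∃ col : (ℤ → ℝ) → (Fin D → Fin L), ∀ h h' : ℤ → ℝ,
        (∀ x, 0 ≤ h x) → (∀ x, h x ≤ 1) → (∀ x, 0 ≤ h' x) → (∀ x, h' x ≤ 1) →
        col h = col h' → ∑ k ∈ s, w k * (g k (fun x => h x - h' x)) ^ 2 ≤ 4 * ζ := by
  set D := ⌈q / ζ⌉₊ with hD
  obtain ⟨σ, hσ, hσ2⟩ : ∃ σ : ℝ, 0 < σ ∧ q * D * σ ^ 2 ≤ ζ := by
    have h1 : 0 ≤ q * D := by positivity
    refine ⟨min 1 (ζ / (q * D + 1)), by positivity, ?_⟩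
    set σ := min 1 (ζ / (q * D + 1)) with hσ
    have hσ0 : 0 < σ := by positivity
    have a : σ ≤ 1 := min_le_left _ _
    have b : σ * (q * D + 1) ≤ ζ := (le_div_iff₀ (by positivity)).1 (min_le_right _ _)
    nlinarith [mul_le_of_le_one_right (mul_nonneg h1 hσ0.le) a]
  refine ⟨D, ⌊2 / σ⌋₊ + 1, fun ι s w g hw hwq hg => ?_⟩
  set Φ : (ℤ → ℝ) → ℝ := fun h => ∑ k ∈ s, w k * (g k h) ^ 2 with hΦ
  have hΦle : ∀ h, Bdd h → Φ h ≤ q * φ (fun x => h x ^ 2) := by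
    intro h hb
    have h0 : 0 ≤ φ (fun x => h x ^ 2) := hφ.pos _ hb.sq (fun x => sq_nonneg _)
    calc Φ h ≤ ∑ k ∈ s, w k * φ (fun x => h x ^ 2) :=
          Finset.sum_le_sum fun k hk => mul_le_mul_of_nonneg_left (hg k hk h hb) (hw k hk)
      _ = (∑ k ∈ s, w k) * φ (fun x => h x ^ 2) := by rw [Finset.sum_mul]
      _ ≤ _ := mul_le_mul_of_nonneg_right hwq h0
  -- good families
  let P : ℕ → Prop := fun d => ∃ e : ℕ → ℤ → ℝ, (∀ j < d, Bdd (e j)) ∧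
    (∀ i < d, ∀ j < d, φ (fun x => e i x * e j x) = if i = j then 1 else 0) ∧
    (∀ j < d, ζ < Φ (e j))
  have hPD : ∀ d, P d → d ≤ D := by
    rintro d ⟨e, heb, heo, heζ⟩
    have h1 : (d:ℝ) * ζ ≤ ∑ j ∈ Finset.range d, Φ (e j) := by
      have := Finset.card_nsmul_le_sum (Finset.range d) (fun j => Φ (e j)) ζ
        (fun j hj => (heζ j (Finset.mem_range.1 hj)).le)
      simpa using this
    have h2 : ∑ j ∈ Finset.range d, Φ (e j) ≤ q := by
      simp only [hΦ]
      rw [Finset.sum_comm]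
      calc _ = ∑ k ∈ s, w k * ∑ j ∈ Finset.range d, (g k (e j)) ^ 2 := by
            simp only [Finset.mul_sum]
        _ ≤ ∑ k ∈ s, w k * 1 := Finset.sum_le_sum fun k hk =>
            mul_le_mul_of_nonneg_left (bessel heb heo (hg k hk)) (hw k hk)
        _ ≤ q := by simpa using hwq
    have h3 : (d:ℝ) ≤ q / ζ := (le_div_iff₀ hζ).2 (h1.trans h2)
    exact_mod_cast h3.trans (Nat.le_ceil _)
  have hP0 : P 0 := ⟨fun _ _ => 0, by simp, by simp, by simp⟩
  classical
  set d := Nat.findGreatest P D with hd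
  have hPd : P d := Nat.findGreatest_spec (P := P) (Nat.zero_le D) hP0
  have hnP : ¬ P (d + 1) := fun hP => by
    have := Nat.le_findGreatest (P := P) (hPD _ hP) hP
    omega
  have hdD : d ≤ D := hPD d hPd
  obtain ⟨e, heb, heo, heζ⟩ := hPd
  have horth : ∀ u, Bdd u → (∀ j < d, φ (fun x => u x * e j x) = 0) →
      Φ u ≤ ζ * φ (fun x => u x ^ 2) := by
    intro u hu huo
    have h0 : 0 ≤ φ (fun x => u x ^ 2) := hφ.pos _ hu.sq (fun x => sq_nonneg _)
    rcases h0.eq_or_lt with h0 | h0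
    · have := hΦle u hu
      rw [← h0] at this ⊢
      simpa using this
    · by_contra hlt
      push Not at hlt
      apply hnP
      set a := (Real.sqrt (φ (fun x => u x ^ 2)))⁻¹ with ha
      have ha2 : a ^ 2 = (φ (fun x => u x ^ 2))⁻¹ := by
        rw [ha, inv_pow, Real.sq_sqrt h0.le]
      refine ⟨fun j => if j = d then (fun x => a * u x) else e j, ?_, ?_, ?_⟩
      · intro j hj
        dsimp only
        split_ifs with hjd
        · exact hu.cmul a
        · exact heb j (by omega)
      · intro i hi j hj
        dsimp only
        have key : ∀ j < d, φ (fun x => a * u x * e j x) = 0 := by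
          intro j hj
          have : (fun x => a * u x * e j x) = fun x => a * (u x * e j x) := by ext x; ring
          rw [this, Fn.cmul, huo j hj, mul_zero]
        by_cases hi' : i = d <;> by_cases hj' : j = d
        · subst hi'; subst hj'
          simp only [if_true]
          have : (fun x => a * u x * (a * u x)) = fun x => a ^ 2 * u x ^ 2 := by ext x; ring
          rw [this, Fn.cmul, ha2, inv_mul_cancel₀ h0.ne']
        · rw [if_pos hi', if_neg hj', if_neg (by omega)]
          exact key j (by omega)
        · rw [if_neg hi', if_pos hj', if_neg (by omega)]
          simpa only [mul_comm] using key i (by omega)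
        · rw [if_neg hi', if_neg hj']
          exact heo i (by omega) j (by omega)
      · intro j hj
        dsimp only
        split_ifs with hjd
        · have : Φ (fun x => a * u x) = a ^ 2 * Φ u := by
            simp only [hΦ, Finset.mul_sum, Fn.cmul]
            refine Finset.sum_congr rfl fun k _ => by ring
          rw [this, ha2, lt_inv_mul_iff₀ h0]
          linarith
        · exact heζ j (by omega)
  refine ⟨fun h j => ⟨min ⌊(φ (fun x => h x * e j x) + 1) / σ⌋₊ ⌊2 / σ⌋₊,
    Nat.lt_succ_of_le (min_le_right _ _)⟩, fun h h' h0 h1 h0' h1' hcol => ?_⟩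
  have hb := Bdd.of01 h0 h1
  have hb' := Bdd.of01 h0' h1'
  set u : ℤ → ℝ := fun x => h x - h' x with hu
  have hub : Bdd u := hb.sub hb'
  have hu1 : φ (fun x => u x ^ 2) ≤ 1 := hφ.le_one hub.sq 1 (fun x => by
    have a := h0 x; have b := h1 x; have c := h0' x; have d := h1' x
    simp only [hu]; nlinarith)
  set α : ℕ → ℝ := fun j => φ (fun x => u x * e j x) with hα
  have hcoef : ∀ h : ℤ → ℝ, (∀ x, 0 ≤ h x) → (∀ x, h x ≤ 1) → ∀ j < d,
      |φ (fun x => h x * e j x)| ≤ 1 := by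
    intro h h0 h1 j hj
    have hb := Bdd.of01 h0 h1
    have a1 : φ (fun x => h x ^ 2) ≤ 1 := hφ.le_one hb.sq 1 (fun x => pow_le_one₀ (h0 x) (h1 x))
    have a2 : φ (fun x => e j x ^ 2) = 1 := by
      have := heo j hj j hj
      simpa only [← sq, if_true] using this
    have a3 := hφ.pos (fun x => (h x - e j x) ^ 2) (hb.sub (heb j hj)).sq (fun x => sq_nonneg _)
    have a4 := hφ.pos (fun x => (h x + e j x) ^ 2) (hb.add (heb j hj)).sq (fun x => sq_nonneg _)
    have e3 : φ (fun x => (h x - e j x) ^ 2) = φ (fun x => h x ^ 2) - 2 * φ (fun x => h x * e j x)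
        + φ (fun x => e j x ^ 2) := by
      rw [← Fn.cmul, ← Fn.sub, ← Fn.add]; congr 1; ext x; ring
    have e4 : φ (fun x => (h x + e j x) ^ 2) = φ (fun x => h x ^ 2) + 2 * φ (fun x => h x * e j x)
        + φ (fun x => e j x ^ 2) := by
      rw [← Fn.cmul, ← Fn.add, ← Fn.add]; congr 1; ext x; ring
    rw [abs_le]; constructor <;> linarith
  have hαs : ∀ j < d, α j ^ 2 ≤ σ ^ 2 := by
    intro j hj
    have hc := congrArg (fun f => ((f ⟨j, by omega⟩ : Fin _) : ℕ)) hcol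
    simp only at hc
    have b1 := abs_le.1 (hcoef h h0 h1 j hj)
    have b2 := abs_le.1 (hcoef h' h0' h1' j hj)
    have e1 : α j = φ (fun x => h x * e j x) - φ (fun x => h' x * e j x) := by
      rw [← Fn.sub]; simp only [hα, hu]; congr 1; ext x; ring
    generalize φ (fun x => h x * e j x) = a at *
    generalize φ (fun x => h' x * e j x) = b at *
    have fl : ∀ a : ℝ, a ≤ 1 → min ⌊(a + 1) / σ⌋₊ ⌊2 / σ⌋₊ = ⌊(a + 1) / σ⌋₊ := fun a ha =>
      min_eq_left (Nat.floor_le_floor (by gcongr; linarith))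
    rw [fl a b1.2, fl b b2.2] at hc
    have pa : 0 ≤ (a + 1) / σ := div_nonneg (by linarith) hσ.le
    have pb : 0 ≤ (b + 1) / σ := div_nonneg (by linarith) hσ.le
    have c1 := Nat.floor_le pa
    have c2 := Nat.lt_floor_add_one ((a + 1) / σ)
    have c3 := Nat.floor_le pb
    have c4 := Nat.lt_floor_add_one ((b + 1) / σ)
    rw [hc] at c1 c2
    have d1 : |(a + 1) / σ - (b + 1) / σ| ≤ 1 := by rw [abs_le]; constructor <;> linarith
    rw [← sub_div, abs_div, abs_of_pos hσ, div_le_one hσ] at d1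
    rw [e1, sq_le_sq, abs_of_pos hσ]
    convert d1 using 2; ring
  -- decomposition
  set uW : ℤ → ℝ := fun x => ∑ j ∈ Finset.range d, α j * e j x with huW
  have huWb : Bdd uW := Bdd.sum _ (fun j hj => (heb j (Finset.mem_range.1 hj)).cmul _)
  set uP : ℤ → ℝ := fun x => u x - uW x with huP
  have huPb : Bdd uP := hub.sub huWb
  have hWe : ∀ j < d, φ (fun x => uW x * e j x) = α j := by
    intro j hj
    have : (fun x => uW x * e j x) = fun x => ∑ i ∈ Finset.range d, α i * (e i x * e j x) := by
      ext x; simp only [huW, Finset.sum_mul, mul_assoc]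
    rw [this, Fn.sum]
    have : ∀ i ∈ Finset.range d, φ (fun x => α i * (e i x * e j x)) = if i = j then α i else 0 := by
      intro i hi
      rw [Fn.cmul, heo i (Finset.mem_range.1 hi) j hj]
      split_ifs <;> simp
    rw [Finset.sum_congr rfl this, Finset.sum_ite_eq']
    simp [hj]
  have hPo : ∀ j < d, φ (fun x => uP x * e j x) = 0 := by
    intro j hj
    have : (fun x => uP x * e j x) = fun x => u x * e j x - uW x * e j x := by
      ext x; simp only [huP, sub_mul]
    rw [this, Fn.sub, hWe j hj]; simp [hα]
  have hlin : ∀ v : ℤ → ℝ, φ (fun x => v x * uW x) =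
      ∑ j ∈ Finset.range d, α j * φ (fun x => v x * e j x) := by
    intro v
    have : (fun x => v x * uW x) = fun x => ∑ j ∈ Finset.range d, α j * (v x * e j x) := by
      ext x; simp only [huW, Finset.mul_sum]
      exact Finset.sum_congr rfl fun j _ => by ring
    rw [this, Fn.sum]
    exact Finset.sum_congr rfl fun j _ => Fn.cmul _ _ _
  have hW2 : φ (fun x => uW x ^ 2) ≤ D * σ ^ 2 := by
    simp only [sq (uW _)]
    rw [hlin]
    calc _ = ∑ j ∈ Finset.range d, α j ^ 2 := Finset.sum_congr rfl fun j hj => by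
          rw [hWe j (Finset.mem_range.1 hj), sq]
      _ ≤ ∑ j ∈ Finset.range d, σ ^ 2 := Finset.sum_le_sum fun j hj => hαs j (Finset.mem_range.1 hj)
      _ = d * σ ^ 2 := by simp
      _ ≤ _ := by gcongr
  have hP2 : φ (fun x => uP x ^ 2) ≤ 1 := by
    have c : φ (fun x => uP x * uW x) = 0 := by
      rw [hlin]
      exact Finset.sum_eq_zero fun j hj => by rw [hPo j (Finset.mem_range.1 hj), mul_zero]
    have : φ (fun x => u x ^ 2) = φ (fun x => uP x ^ 2) + 2 * φ (fun x => uP x * uW x)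
        + φ (fun x => uW x ^ 2) := by
      rw [← Fn.cmul, ← Fn.add, ← Fn.add]; congr 1; ext x; simp only [huP]; ring
    have := hφ.pos _ huWb.sq (fun x => sq_nonneg _)
    linarith
  have f1 : Φ u ≤ 2 * Φ uW + 2 * Φ uP := by
    simp only [hΦ, Finset.mul_sum]
    rw [← Finset.sum_add_distrib]
    refine Finset.sum_le_sum fun k hk => ?_
    have : g k u = g k uW + g k uP := by
      rw [← Fn.add]; congr 1; ext x; simp only [huP]; ring
    rw [this]
    nlinarith [mul_nonneg (hw k hk) (sq_nonneg (g k uW - g k uP))]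
  have f2 : Φ uW ≤ ζ := by
    have := hΦle uW huWb
    have := mul_le_mul_of_nonneg_left hW2 hq
    nlinarith
  have f3 : Φ uP ≤ ζ := by
    have := horth uP huPb hPo
    nlinarith
  change Φ u ≤ _
  linarith

open Filter Topology

noncomputable def d0 (q : ℕ) (v : ℕ → ℤ → ℝ) (x y : ℤ) : ℝ :=
  ∑ i ∈ Finset.range q, |v i x - v i y|

noncomputable def distS (S q : ℕ) (v : ℕ → ℤ → ℝ) (x y : ℤ) : ℝ :=
  (∑ s ∈ Finset.range S, d0 q v (x + s) (y + s)) / S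

noncomputable def kap (η : ℝ) (S q : ℕ) (v : ℕ → ℤ → ℝ) (x y : ℤ) : ℝ :=
  max 0 (1 - distS S q v x y / η)

theorem d0_nonneg (q v x y) : 0 ≤ d0 q v x y := Finset.sum_nonneg fun _ _ => abs_nonneg _

theorem d0_le {q : ℕ} {v : ℕ → ℤ → ℝ} (h0 : ∀ i < q, ∀ x, 0 ≤ v i x) (h1 : ∀ i < q, ∀ x, v i x ≤ 1)
    (x y : ℤ) : d0 q v x y ≤ q := by
  have := Finset.sum_le_card_nsmul (Finset.range q) (fun i => |v i x - v i y|) 1 (fun i hi => by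
    have hi := Finset.mem_range.1 hi
    have a := h0 i hi x; have b := h0 i hi y; have c := h1 i hi x; have d := h1 i hi y
    rw [abs_le]; constructor <;> linarith)
  simpa [d0] using this

theorem distS_nonneg (S q v x y) : 0 ≤ distS S q v x y :=
  div_nonneg (Finset.sum_nonneg fun _ _ => d0_nonneg _ _ _ _) (Nat.cast_nonneg _)

theorem distS_shift {S q : ℕ} {v : ℕ → ℤ → ℝ} (h0 : ∀ i < q, ∀ x, 0 ≤ v i x)
    (h1 : ∀ i < q, ∀ x, v i x ≤ 1) (t : ℕ) (x y : ℤ) :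
    distS S q v x y ≤ distS S q v (x + t) (y + t) + t * (q / S) := by
  induction t with
  | zero => simp
  | succ t ih =>
    refine ih.trans ?_
    have a1 := Finset.sum_range_succ (fun s : ℕ => d0 q v (x + t + s) (y + t + s)) S
    have a2 := Finset.sum_range_succ' (fun s : ℕ => d0 q v (x + t + s) (y + t + s)) S
    have a3 : ∑ s ∈ Finset.range S, d0 q v (x + (t + 1 : ℕ) + s) (y + (t + 1 : ℕ) + s)
        = ∑ s ∈ Finset.range S, d0 q v (x + t + (s + 1 : ℕ)) (y + t + (s + 1 : ℕ)) :=
      Finset.sum_congr rfl fun s _ => by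
        congr 1 <;> (push_cast; ring)
    have a4 := d0_le h0 h1 (x + t + (0:ℕ)) (y + t + (0:ℕ))
    have a5 := d0_nonneg q v (x + t + S) (y + t + S)
    have key : ∑ s ∈ Finset.range S, d0 q v (x + t + s) (y + t + s) ≤
        ∑ s ∈ Finset.range S, d0 q v (x + (t + 1 : ℕ) + s) (y + (t + 1 : ℕ) + s) + q := by
      linarith
    have key2 : distS S q v (x + t) (y + t) ≤
        distS S q v (x + (t + 1 : ℕ)) (y + (t + 1 : ℕ)) + q / S := by
      unfold distS
      rw [← add_div]
      gcongr
    push_cast at key2 ⊢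
    linarith

theorem kap_ker {η : ℝ} (hη : 0 < η) {S q : ℕ} {v : ℕ → ℤ → ℝ} (h0 : ∀ i < q, ∀ x, 0 ≤ v i x)
    (h1 : ∀ i < q, ∀ x, v i x ≤ 1) : Ker (kap η S q v) (q / S / η) where
  nonneg x y := le_max_left _ _
  le_one x y := max_le zero_le_one (by
    have := div_nonneg (distS_nonneg S q v x y) hη.le
    linarith)
  rpos := by positivity
  inv t x y := by
    have hp : 0 ≤ (t:ℝ) * (q / S / η) := by positivity
    refine max_le (add_nonneg (le_max_left _ _) hp) ?_
    have := distS_shift (S := S) h0 h1 t x y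
    have h2 : distS S q v x y / η ≤ distS S q v (x + t) (y + t) / η + t * (q / S / η) := by
      calc _ ≤ (distS S q v (x + t) (y + t) + t * (q / S)) / η := by gcongr
        _ = _ := by ring
    have h3 := le_max_right 0 (1 - distS S q v x y / η)
    unfold kap
    linarith

theorem kap_dist {η : ℝ} (hη : 0 < η) (S q : ℕ) (v : ℕ → ℤ → ℝ) (x y : ℤ) :
    kap η S q v x y * distS S q v x y ≤ η * kap η S q v x y := by
  rw [mul_comm η]
  rcases le_total (1 - distS S q v x y / η) 0 with h | h
  · have : kap η S q v x y = 0 := max_eq_left h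
    rw [this]; simp
  · refine mul_le_mul_of_nonneg_left ?_ (le_max_left _ _)
    have : distS S q v x y / η ≤ 1 := by linarith
    rwa [div_le_one hη] at this

theorem pos_cs {φ lam : Fn} (h : IsMean φ) (hl : IsPos lam) (hd : Dom lam φ) {f : ℤ → ℝ}
    (hf : Bdd f) : (lam f) ^ 2 ≤ φ (fun x => f x ^ 2) := by
  have h1 : lam (fun _ => 1) ≤ 1 :=
    (hd (fun _ => 1) (Bdd.const _) (fun _ => zero_le_one)).trans_eq h.one
  have a := hl (fun x => (f x - lam f) ^ 2) (hf.sub (Bdd.const _)).sq (fun x => sq_nonneg _)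
  have e : lam (fun x => (f x - lam f) ^ 2) = lam (fun x => f x ^ 2) - 2 * lam f * lam f
      + (lam f) ^ 2 * lam (fun _ => 1) := by
    rw [← Fn.cmul, ← Fn.const, ← Fn.sub, ← Fn.add]; congr 1; ext x; ring
  have b := hd (fun x => f x ^ 2) hf.sq (fun x => sq_nonneg _)
  rw [e] at a
  nlinarith [sq_nonneg (lam f)]

/-- values of a functional on the fibres -/
noncomputable def val (m ℓ : ℕ) (T : Set ℤ) (lam : Fn) (c : ℤ) : ℝ := lam (ind (fib m ℓ T c))

theorem val_nonneg {m ℓ : ℕ} {T : Set ℤ} {lam : Fn} (hl : IsPos lam) (c : ℤ) :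
    0 ≤ val m ℓ T lam c := hl _ (ind_bdd _) (ind_nonneg _)

theorem val_le_one {m ℓ : ℕ} {T : Set ℤ} {φ lam : Fn} (h : IsMean φ) (hd : Dom lam φ)
    (c : ℤ) : val m ℓ T lam c ≤ 1 :=
  (hd _ (ind_bdd _) (ind_nonneg _)).trans (h.le_one (ind_bdd _) 1 (ind_le_one _))

theorem mass_color {φ : Fn} (h : IsMean φ) {κ r} (hk : Ker κ r) {C : Type} [Fintype C]
    (col : ℤ → C) (hc : ∀ x y, col x = col y → 1 / 2 ≤ κ x y) :
    1 / (2 * (Fintype.card C : ℝ)) ≤ mass φ κ := by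
  classical
  have : Nonempty C := ⟨col 0⟩
  set I : C → ℤ → ℝ := fun k => ind (col ⁻¹' {k}) with hI
  have hsum : ∀ x, ∑ k, I k x = 1 := by
    intro x
    rw [Finset.sum_eq_single (col x)]
    · exact ind_mem (by simp)
    · intro k _ hk
      exact ind_not_mem (by simpa using hk.symm)
    · simp
  have hb : ∀ k, Bdd (I k) := fun k => ind_bdd _
  have h1 : ∀ x, ∑ k, (1 / 2 * φ (I k)) * I k x ≤ φ (κ x) := by
    intro x
    have : ∑ k, (1 / 2 * φ (I k)) * I k x = φ (fun y => ∑ k, (1 / 2 * I k x) * I k y) := by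
      rw [Fn.sum]
      refine Finset.sum_congr rfl fun k _ => ?_
      rw [Fn.cmul]; ring
    rw [this]
    refine h.pos.mono (Bdd.sum _ fun k _ => (hb k).cmul _) (hk.bdd x) (fun y => ?_)
    rw [Finset.sum_eq_single (col x)]
    · by_cases hxy : col y = col x
      · have a := hc x y hxy.symm
        rw [hI]; dsimp only
        rw [ind_mem (by simp), ind_mem (by simpa using hxy)]
        linarith
      · rw [hI]; dsimp only
        rw [ind_not_mem (x := y) (by simpa using hxy), mul_zero]
        exact hk.nonneg x y
    · intro k _ hk
      rw [hI]; dsimp only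
      rw [ind_not_mem (x := x) (by simpa using hk.symm)]; ring
    · simp
  have h2 := h.pos.mono (Bdd.sum _ fun k _ => (hb k).cmul _) (hk.M_bdd h) h1
  rw [Fn.sum] at h2
  have h3 : ∑ k, φ (I k) = 1 := by
    rw [← Fn.sum, ← h.one]; congr 1; ext x; exact hsum x
  have h4 := sq_sum_le_card_mul_sum_sq (s := Finset.univ) (f := fun k => φ (I k))
  rw [h3] at h4
  have h5 : ∑ k, φ (fun x => (1 / 2 * φ (I k)) * I k x) = 1 / 2 * ∑ k, φ (I k) ^ 2 := by
    rw [Finset.mul_sum]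
    refine Finset.sum_congr rfl fun k _ => ?_
    rw [Fn.cmul]; ring
  rw [h5] at h2
  have hcard : (0:ℝ) < Fintype.card C := by exact_mod_cast Fintype.card_pos
  rw [div_le_iff₀ (by positivity)]
  unfold mass
  rw [Finset.card_univ] at h4
  nlinarith

theorem Nlow {φ : Fn} (h : IsMean φ) (m ℓ : ℕ) (hℓ : 0 < ℓ) (T : Set ℤ) (q : ℕ) (lam : ℕ → Fn)
    (hl : ∀ i < q, IsPos (lam i)) (hd : ∀ i < q, Dom (lam i) φ) {η : ℝ} (hη : 0 < η) :
    ∃ p > 0, ∀ S : ℕ, 0 < S → p ≤ mass φ (kap η S q (fun i => val m ℓ T (lam i))) := by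
  set v : ℕ → ℤ → ℝ := fun i => val m ℓ T (lam i) with hv
  have hv0 : ∀ i < q, ∀ x, 0 ≤ v i x := fun i hi x => val_nonneg (hl i hi) x
  have hv1 : ∀ i < q, ∀ x, v i x ≤ 1 := fun i hi x => val_le_one h (hd i hi) x
  obtain ⟨ζ, hζ, hζ2⟩ : ∃ ζ : ℝ, 0 < ζ ∧ (q:ℝ) * (ℓ * (4 * ζ)) ≤ (η / 2) ^ 2 := by
    refine ⟨(η / 2) ^ 2 / (4 * q * ℓ + 1), by positivity, ?_⟩
    have : (q:ℝ) * (ℓ * (4 * ((η / 2) ^ 2 / (4 * q * ℓ + 1)))) =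
      (η / 2) ^ 2 * ((4 * q * ℓ) / (4 * q * ℓ + 1)) := by ring
    rw [this]
    refine mul_le_of_le_one_right (by positivity) ?_
    rw [div_le_one (by positivity)]; linarith
  obtain ⟨D, L, hTB⟩ := TB h (q := q) (Nat.cast_nonneg q) hζ
  classical
  refine ⟨if Nonempty (Fin ℓ → (Fin D → Fin L)) then
    1 / (2 * (Fintype.card (Fin ℓ → (Fin D → Fin L)) : ℝ)) else 1, ?_, fun S hS => ?_⟩
  · split_ifs with hne
    · have : 0 < Fintype.card (Fin ℓ → (Fin D → Fin L)) := Fintype.card_pos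
      positivity
    · exact one_pos
  have hS' : (0:ℝ) < S := by exact_mod_cast hS
  set g : ℕ × ℕ → Fn := fun k =>
    (lam k.2).comp (LinearMap.funLeft ℝ ℝ (fun x : ℤ => x + m * (k.1 / ℓ : ℕ))) with hg
  have hgap : ∀ k f, g k f = lam k.2 (fun x => f (x + m * (k.1 / ℓ : ℕ))) := fun k f => rfl
  obtain ⟨col, hcol⟩ := hTB (ℕ × ℕ) (Finset.range S ×ˢ Finset.range q) (fun _ => 1 / S) g
    (fun _ _ => by positivity) (by
      rw [Finset.sum_const, Finset.card_product, Finset.card_range, Finset.card_range,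
        nsmul_eq_mul]
      push_cast
      apply le_of_eq; field_simp)
    (fun k hk f hf => by
      have hk2 : k.2 < q := Finset.mem_range.1 (Finset.mem_product.1 hk).2
      rw [hgap, ← h.inv _ hf.sq (m * (k.1 / ℓ : ℕ))]
      exact pos_cs h (hl _ hk2) (hd _ hk2) (hf.shift _))
  let co : ℤ → (Fin ℓ → (Fin D → Fin L)) := fun c j => col (ind (fib m ℓ T (c + (j:ℕ))))
  rw [if_pos ⟨co 0⟩]
  refine mass_color h (kap_ker hη hv0 hv1) co (fun x y hxy => ?_)
  -- same colour implies small distance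
  have hval : ∀ (c : ℤ) (s i : ℕ), v i (c + s) = g (s, i) (ind (fib m ℓ T (c + (s % ℓ : ℕ)))) := by
    intro c s i
    rw [hgap]
    simp only [hv, val]
    congr 1; ext b
    rw [← ind_fib_shift]
    have : c + (s:ℤ) = c + (s % ℓ : ℕ) + ℓ * (s / ℓ : ℕ) := by
      rw [add_assoc]; congr 1
      exact_mod_cast (Nat.mod_add_div s ℓ).symm
    rw [this]
  have hdist : distS S q v x y = ∑ k ∈ Finset.range S ×ˢ Finset.range q,
      (1 / S : ℝ) * |v k.2 (x + k.1) - v k.2 (y + k.1)| := by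
    rw [← Finset.mul_sum, Finset.sum_product, distS, div_eq_inv_mul, one_div]
    rfl
  have hcs : distS S q v x y ^ 2 ≤ q * ∑ k ∈ Finset.range S ×ˢ Finset.range q,
      (1 / S : ℝ) * (v k.2 (x + k.1) - v k.2 (y + k.1)) ^ 2 := by
    rw [hdist, ← Finset.mul_sum, ← Finset.mul_sum, mul_pow]
    have := sq_sum_le_card_mul_sum_sq (s := Finset.range S ×ˢ Finset.range q)
      (f := fun k => |v k.2 (x + k.1) - v k.2 (y + k.1)|)
    rw [Finset.card_product, Finset.card_range, Finset.card_range] at this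
    simp only [sq_abs] at this
    push_cast at this
    calc _ ≤ (1 / S : ℝ) ^ 2 * (S * q * ∑ k ∈ Finset.range S ×ˢ Finset.range q,
          (v k.2 (x + k.1) - v k.2 (y + k.1)) ^ 2) := by gcongr
      _ = _ := by field_simp
  have hsum : ∑ k ∈ Finset.range S ×ˢ Finset.range q,
      (1 / S : ℝ) * (v k.2 (x + k.1) - v k.2 (y + k.1)) ^ 2 ≤ ℓ * (4 * ζ) := by
    have : ∀ j ∈ Finset.range ℓ, ∑ k ∈ Finset.range S ×ˢ Finset.range q, (1 / S : ℝ) *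
        (g k (fun b => ind (fib m ℓ T (x + j)) b - ind (fib m ℓ T (y + j)) b)) ^ 2 ≤ 4 * ζ := by
      intro j hj
      refine hcol _ _ (ind_nonneg _) (ind_le_one _) (ind_nonneg _) (ind_le_one _) ?_
      exact congrFun hxy ⟨j, Finset.mem_range.1 hj⟩
    have h2 := Finset.sum_le_sum this
    rw [Finset.sum_const, Finset.card_range, nsmul_eq_mul] at h2
    refine le_trans ?_ h2
    rw [Finset.sum_comm]
    refine Finset.sum_le_sum fun k hk => ?_
    rw [hval x k.1 k.2, hval y k.1 k.2, ← Fn.sub]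
    exact Finset.single_le_sum (f := fun j : ℕ => (1 / S : ℝ) *
        (g k (fun b => ind (fib m ℓ T (x + j)) b - ind (fib m ℓ T (y + j)) b)) ^ 2)
      (fun j _ => by positivity) (Finset.mem_range.2 (Nat.mod_lt _ hℓ))
  have hfin : distS S q v x y ≤ η / 2 := by
    refine le_of_sq_le_sq ?_ (by positivity)
    refine hcs.trans (le_trans ?_ hζ2)
    gcongr
  have : distS S q v x y / η ≤ 1 / 2 := by
    rw [div_le_iff₀ hη]; linarith
  exact le_max_of_le_right (by linarith)

open Filter Topology

/-- functionals that vanish on the set of points with large fibres -/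
def Bad (m ℓ : ℕ) (T : Set ℤ) (lam : Fn) : Prop :=
  ∀ ε > 0, lam (ind {c | ε ≤ val m ℓ T lam c}) = 0

theorem small_Z {φ : Fn} (h : IsMean φ) (v : ℤ → ℝ) {δ : ℝ} (hδ : 0 < δ) :
    ∃ ε0 > 0, ∀ ε1 ≤ ε0, ∀ ε' > 0, φ (ind {x | ε' ≤ v x ∧ v x < ε1}) ≤ δ := by
  let F : ℝ → ℝ := fun ε => φ (ind {x | v x < ε})
  let S : Set ℝ := F '' {ε | 0 < ε}
  have hlb : ∀ y ∈ S, 0 ≤ y := by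
    rintro _ ⟨ε, _, rfl⟩
    exact h.pos _ (ind_bdd _) (ind_nonneg _)
  have hne : S.Nonempty := ⟨_, 1, (one_pos : (0:ℝ) < 1), rfl⟩
  obtain ⟨_, ⟨ε0, hε0, rfl⟩, hlt⟩ := exists_lt_of_csInf_lt hne
    (show sInf S < sInf S + δ by linarith)
  refine ⟨ε0, hε0, fun ε1 h1 ε' hε' => ?_⟩
  have a : sInf S ≤ F ε' := csInf_le ⟨0, hlb⟩ ⟨ε', hε', rfl⟩
  have b : φ (ind {x | ε' ≤ v x ∧ v x < ε1}) ≤ φ (fun x => ind {x | v x < ε0} x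
      - ind {x | v x < ε'} x + ind {x | v x < ε' ∧ ε0 ≤ v x} x) := by
    refine h.pos.mono (ind_bdd _) (((ind_bdd _).sub (ind_bdd _)).add (ind_bdd _)) (fun x => ?_)
    by_cases hx : v x < ε'
    · rw [ind_not_mem (show x ∉ {x | ε' ≤ v x ∧ v x < ε1} from fun hh => absurd hh.1 (not_le.2 hx)),
        ind_mem (show x ∈ {x | v x < ε'} from hx)]
      by_cases hx2 : v x < ε0
      · rw [ind_mem (show x ∈ {x | v x < ε0} from hx2)]
        have := ind_nonneg {x | v x < ε' ∧ ε0 ≤ v x} x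
        linarith
      · rw [ind_mem (show x ∈ {x | v x < ε' ∧ ε0 ≤ v x} from ⟨hx, not_lt.1 hx2⟩)]
        have := ind_nonneg {x | v x < ε0} x
        linarith
    · rw [ind_not_mem (show x ∉ {x | v x < ε'} from hx)]
      have n1 := ind_nonneg {x | v x < ε' ∧ ε0 ≤ v x} x
      by_cases hx2 : v x < ε1
      · rw [ind_mem (show x ∈ {x | v x < ε0} from hx2.trans_le h1)]
        have := ind_le_one {x | ε' ≤ v x ∧ v x < ε1} x
        linarith
      · rw [ind_not_mem (show x ∉ {x | ε' ≤ v x ∧ v x < ε1} from fun hh => hx2 hh.2)]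
        have := ind_nonneg {x | v x < ε0} x
        linarith
  by_cases hc : ε' ≤ ε0
  · have e : ind {x | v x < ε' ∧ ε0 ≤ v x} = fun _ => 0 := by
      ext x
      exact ind_not_mem (fun hh => absurd (hh.1.trans_le (hc.trans hh.2)) (lt_irrefl _))
    rw [Fn.add, Fn.sub, e, h.cst] at b
    have b' : φ (ind {x | ε' ≤ v x ∧ v x < ε1}) ≤ F ε0 - F ε' + 0 := b
    linarith
  · have e : ind {x | ε' ≤ v x ∧ v x < ε1} = fun _ => 0 := by
      ext x
      exact ind_not_mem (fun hh => by
        have h2 : ε' ≤ v x := hh.1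
        have h3 : v x < ε1 := hh.2
        linarith)
    rw [e, h.cst]; exact hδ.le

theorem exists_min_pos (q : ℕ) (e : ℕ → ℝ) (he : ∀ i < q, 0 < e i) :
    ∃ ε0 > 0, ∀ i < q, ε0 ≤ e i := by
  induction q with
  | zero => exact ⟨1, one_pos, by simp⟩
  | succ q ih =>
    obtain ⟨ε, hε, h⟩ := ih (fun i hi => he i (by omega))
    refine ⟨min ε (e q), lt_min hε (he q (by omega)), fun i hi => ?_⟩
    rcases Nat.lt_succ_iff_lt_or_eq.1 hi with hi | rfl
    · exact (min_le_left _ _).trans (h i hi)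
    · exact min_le_right _ _

theorem T1_term {φ lam : Fn} (h : IsMean φ) {m ℓ : ℕ} {T : Set ℤ} {q i : ℕ} (hi : i < q)
    {v : ℕ → ℤ → ℝ} (hvi : v i = val m ℓ T lam) (hl : IsPos lam) (hd : Dom lam φ)
    (hbad : Bad m ℓ T lam) {κ r} (hk : Ker κ r) {ε0 ε' : ℝ} (hε0 : 0 < ε0) (hε' : 0 < ε')
    (s x : ℤ) (hv : ∀ y, d0 q v (x + s) y ≤ q) :
    lam (fun y => κ x (y - s) * ind (fib m ℓ T (x + s)) y) ≤
      ε' + ind {x | ε' ≤ v i x ∧ v i x < ε0} (x + s) * φ (κ x)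
        + (2 / ε0) * φ (fun y => κ x y * d0 q v (x + s) (y + s)) := by
  set a := ind (fib m ℓ T (x + s)) with ha
  have hab : Bdd a := ind_bdd _
  have hkb : Bdd (fun y => κ x (y - s)) := (hk.bdd x).shift' s
  have hdb : Bdd (fun y => d0 q v (x + s) y) :=
    ⟨q, fun y => by rw [abs_of_nonneg (d0_nonneg _ _ _ _)]; exact hv y⟩
  have n1 : 0 ≤ ind {x | ε' ≤ v i x ∧ v i x < ε0} (x + s) * φ (κ x) :=
    mul_nonneg (ind_nonneg _ _) (hk.M_nonneg h x)
  have n2 : 0 ≤ (2 / ε0) * φ (fun y => κ x y * d0 q v (x + s) (y + s)) :=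
    mul_nonneg (by positivity) (h.pos _ ((hk.bdd x).mul (hdb.shift s))
      (fun y => mul_nonneg (hk.nonneg _ _) (d0_nonneg _ _ _ _)))
  have hka : lam (fun y => κ x (y - s) * a y) ≤ lam (fun y => κ x (y - s)) :=
    hl.mono (hkb.mul hab) hkb (fun y => mul_le_of_le_one_right (hk.nonneg _ _) (ind_le_one _ _))
  by_cases c1 : v i (x + s) < ε'
  · have : lam (fun y => κ x (y - s) * a y) ≤ lam a :=
      hl.mono (hkb.mul hab) hab (fun y => mul_le_of_le_one_left (ind_nonneg _ _) (hk.le_one _ _))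
    have e : lam a = v i (x + s) := by rw [hvi]; rfl
    linarith
  by_cases c2 : v i (x + s) < ε0
  · rw [ind_mem (show x + s ∈ {x | ε' ≤ v i x ∧ v i x < ε0} from ⟨not_lt.1 c1, c2⟩), one_mul]
    have := hd _ hkb (fun y => hk.nonneg _ _)
    rw [h.inv' (hk.bdd x)] at this
    linarith
  · push Not at c2
    set W : Set ℤ := {c | ε0 / 2 ≤ val m ℓ T lam c} with hW
    have hW0 : lam (ind W) = 0 := hbad _ (by positivity)
    have b1 : lam (fun y => κ x (y - s)) ≤
        lam (fun y => κ x (y - s) * (1 - ind W y) + ind W y) :=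
      hl.mono hkb ((hkb.mul ((Bdd.const 1).sub (ind_bdd W))).add (ind_bdd W)) (fun y => by
        have := mul_le_of_le_one_left (ind_nonneg W y) (hk.le_one x (y - s))
        nlinarith)
    rw [Fn.add, hW0, add_zero] at b1
    have b2 := hd (fun y => κ x (y - s) * (1 - ind W y))
      (hkb.mul ((Bdd.const 1).sub (ind_bdd W)))
      (fun y => mul_nonneg (hk.nonneg _ _) (by linarith [ind_le_one W y]))
    have b3 : φ (fun y => κ x (y - s) * (1 - ind W y)) ≤
        φ (fun y => (2 / ε0) * (κ x (y - s) * d0 q v (x + s) y)) := by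
      refine h.pos.mono (hkb.mul ((Bdd.const 1).sub (ind_bdd W))) ((hkb.mul hdb).cmul _)
        (fun y => ?_)
      have hkn := hk.nonneg x (y - s)
      by_cases hy : y ∈ W
      · rw [ind_mem hy]
        have := d0_nonneg q v (x + s) y
        simp only [sub_self, mul_zero]
        positivity
      · rw [ind_not_mem hy]
        have hy' : v i y < ε0 / 2 := by rw [hvi]; exact not_le.1 hy
        have g1 : ε0 / 2 ≤ |v i (x + s) - v i y| := le_trans (by linarith) (le_abs_self _)
        have g2 : |v i (x + s) - v i y| ≤ d0 q v (x + s) y :=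
          Finset.single_le_sum (f := fun i => |v i (x + s) - v i y|)
            (fun _ _ => abs_nonneg _) (Finset.mem_range.2 hi)
        have g3 : 1 ≤ 2 / ε0 * d0 q v (x + s) y := by
          rw [div_mul_eq_mul_div, le_div_iff₀ hε0]; linarith
        calc κ x (y - s) * (1 - 0) = κ x (y - s) * 1 := by ring
          _ ≤ κ x (y - s) * (2 / ε0 * d0 q v (x + s) y) := mul_le_mul_of_nonneg_left g3 hkn
          _ = _ := by ring
    rw [Fn.cmul, ← h.inv _ (hkb.mul hdb) s] at b3
    simp only [add_sub_cancel_right] at b3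
    linarith

theorem claimA {φ : Fn} (h : IsMean φ) (he : Erg φ) (m ℓ : ℕ) (hℓ : 0 < ℓ) (T : Set ℤ)
    (q : ℕ) (lam : ℕ → Fn) (hl : ∀ i < q, IsPos (lam i)) (hbad : ∀ i < q, Bad m ℓ T (lam i))
    (hsum : ∀ f, Bdd f → (∀ x, 0 ≤ f x) → ∑ i ∈ Finset.range q, lam i f ≤ φ f) :
    ∑ i ∈ Finset.range q, lam i (fun _ => 1) ≤
      ((m + ℓ : ℕ):ℝ) * ((∑ j ∈ Finset.range ℓ, φ (ind (fib m ℓ Tᶜ j))) / ℓ) := by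
  set R := ((m + ℓ : ℕ):ℝ) * ((∑ j ∈ Finset.range ℓ, φ (ind (fib m ℓ Tᶜ j))) / ℓ) with hR
  set ω : Fn := φ - ∑ i ∈ Finset.range q, lam i with hω
  have hωap : ∀ f, ω f = φ f - ∑ i ∈ Finset.range q, lam i f := fun f => by
    rw [hω, LinearMap.sub_apply, LinearMap.sum_apply]
  have hωp : IsPos ω := fun f hf h0 => by rw [hωap]; linarith [hsum f hf h0]
  have hωd : Dom ω φ := fun f hf h0 => by
    rw [hωap]
    have : 0 ≤ ∑ i ∈ Finset.range q, lam i f :=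
      Finset.sum_nonneg fun i hi => hl i (Finset.mem_range.1 hi) f hf h0
    linarith
  have hd : ∀ i < q, Dom (lam i) φ := fun i hi f hf h0 =>
    (Finset.single_le_sum (f := fun i => lam i f)
      (fun i hi => hl i (Finset.mem_range.1 hi) f hf h0) (Finset.mem_range.2 hi)).trans
      (hsum f hf h0)
  suffices H : ∀ ε1 > 0, (1:ℝ) ≤ ω (fun _ => 1) + R + 7 * ε1 by
    have : (1:ℝ) ≤ ω (fun _ => 1) + R := by
      refine le_of_forall_pos_le_add fun ε hε => ?_
      have := H (ε / 7) (by positivity)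
      linarith
    rw [hωap, h.one] at this
    linarith
  intro ε1 hε1
  set v : ℕ → ℤ → ℝ := fun i => val m ℓ T (lam i) with hv
  have hv0 : ∀ i < q, ∀ x, 0 ≤ v i x := fun i hi x => val_nonneg (hl i hi) x
  have hv1 : ∀ i < q, ∀ x, v i x ≤ 1 := fun i hi x => val_le_one h (hd i hi) x
  have hQ : (0:ℝ) < q + 1 := by positivity
  choose e0 he0 he0' using fun i => small_Z h (v i) (show 0 < ε1 / (q + 1) by positivity)
  obtain ⟨ε0, hε0, hε0'⟩ := exists_min_pos q e0 (fun i _ => he0 i)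
  set η := ε0 * ε1 / (2 * (q + 1)) with hη
  have hηp : 0 < η := by positivity
  obtain ⟨p, hp, hN⟩ := Nlow h m ℓ hℓ T q lam hl hd hηp
  set ε' := ε1 * p / (q + 1) with hε'
  have hε'p : 0 < ε' := by positivity
  set Z : ℕ → Set ℤ := fun i => {x | ε' ≤ v i x ∧ v i x < ε0} with hZ
  have hZs : ∀ i < q, φ (ind (Z i)) ≤ ε1 / (q + 1) := fun i hi =>
    he0' i ε0 (hε0' i hi) ε' hε'p
  choose τ1 hτ1 using fun i => T1z h he (Z i) hε'p
  obtain ⟨τ2, hτ2⟩ := T2 h he hωp hωd (show 0 < ε1 * p by positivity)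
  obtain ⟨τ3, hτ3⟩ := T3 h he m ℓ hℓ Tᶜ (show 0 < ε1 * p by positivity)
  set τ : ℝ := (∑ i ∈ Finset.range q, (τ1 i : ℝ)) + τ2 + τ3 with hτ
  have hτ0 : 0 ≤ τ := by positivity
  obtain ⟨S, hS⟩ := exists_nat_gt (τ * q / (η * (ε1 * p)))
  have hS0 : (0:ℝ) < S := lt_of_le_of_lt (by positivity) hS
  have hS1 : 0 < S := by exact_mod_cast hS0
  set κ := kap η S q v with hκ
  set r : ℝ := q / S / η with hr
  have hk : Ker κ r := kap_ker hηp hv0 hv1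
  have hτr : τ * r ≤ ε1 * p := by
    rw [div_lt_iff₀ (by positivity)] at hS
    rw [hr, div_div, ← mul_div_assoc, div_le_iff₀ (by positivity)]
    nlinarith
  set N := mass φ κ with hNdef
  have hpN : p ≤ N := hN S hS1
  -- choice of the shift
  have hd0b : ∀ x y, |κ x y * d0 q v x y| ≤ q := fun x y => by
    rw [abs_of_nonneg (mul_nonneg (hk.nonneg _ _) (d0_nonneg _ _ _ _))]
    exact (mul_le_of_le_one_left (d0_nonneg _ _ _ _) (hk.le_one _ _)).trans (d0_le hv0 hv1 _ _)
  have hd0b' : ∀ s x y, |κ x y * d0 q v (x + s) (y + s)| ≤ q := fun s x y => by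
    rw [abs_of_nonneg (mul_nonneg (hk.nonneg _ _) (d0_nonneg _ _ _ _))]
    exact (mul_le_of_le_one_left (d0_nonneg _ _ _ _) (hk.le_one _ _)).trans (d0_le hv0 hv1 _ _)
  set Q : ℤ → ℝ := fun s => φ (fun x => φ (fun y => κ x y * d0 q v (x + s) (y + s))) with hQdef
  obtain ⟨s, hs⟩ : ∃ s : ℕ, Q s ≤ η * N := by
    have e : φ (fun x => φ (fun y => κ x y * distS S q v x y)) =
        (∑ s ∈ Finset.range S, Q s) / S := by
      rw [hQdef]
      dsimp only
      rw [← Fn.avg_eq]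
      congr 1; ext x
      rw [← Fn.avg_eq]
      congr 1; ext y
      rw [distS, ← Finset.mul_sum, mul_div_assoc]
    have hdl : ∀ x y, distS S q v x y ≤ q := fun x y =>
      avg_le_of_le hS1 (fun s _ => d0_le hv0 hv1 _ _)
    have hab : ∀ x y, |κ x y * distS S q v x y| ≤ q := fun x y => by
      rw [abs_of_nonneg (mul_nonneg (hk.nonneg _ _) (distS_nonneg _ _ _ _ _))]
      exact (mul_le_of_le_one_left (distS_nonneg _ _ _ _ _) (hk.le_one _ _)).trans (hdl _ _)
    have hle : φ (fun x => φ (fun y => κ x y * distS S q v x y)) ≤ φ (fun x => η * φ (κ x)) := by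
      refine h.pos.mono (h.pos.bdd2 hab) ((hk.M_bdd h).cmul η) (fun x => ?_)
      rw [← Fn.cmul]
      exact h.pos.mono ⟨q, hab x⟩ ((hk.bdd x).cmul η) (fun y => kap_dist hηp S q v x y)
    rw [Fn.cmul, e, div_le_iff₀ hS0] at hle
    by_contra hcon
    push Not at hcon
    have : ∑ s ∈ Finset.range S, η * N < ∑ s ∈ Finset.range S, Q (s:ℤ) :=
      Finset.sum_lt_sum_of_nonempty (by simpa using hS1.ne') (fun s _ => hcon s)
    rw [Finset.sum_const, Finset.card_range, nsmul_eq_mul] at this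
    have h2 : η * φ (fun x => φ (κ x)) = η * N := rfl
    rw [h2] at hle
    linarith
  -- pointwise inequality
  have hpt : ∀ x, φ (fun y => κ x (y - s)) ≤
      (∑ i ∈ Finset.range q, (ε' + ind (Z i) (x + s) * φ (κ x)
        + (2 / ε0) * φ (fun y => κ x y * d0 q v (x + s) (y + s))))
      + ω (fun y => κ x (y - s))
      + φ (fun y => ind (fib m ℓ Tᶜ (x + s)) y * κ x (y - s)) := by
    intro x
    have hkb : Bdd (fun y => κ x (y - s)) := (hk.bdd x).shift' s
    have hab : Bdd (ind (fib m ℓ T (x + s))) := ind_bdd _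
    have e1 : φ (fun y => κ x (y - s)) = φ (fun y => κ x (y - s) * ind (fib m ℓ T (x + s)) y)
        + φ (fun y => ind (fib m ℓ Tᶜ (x + s)) y * κ x (y - s)) := by
      rw [← Fn.add]; congr 1; ext y
      have : ind (fib m ℓ Tᶜ (x + s)) y = 1 - ind (fib m ℓ T (x + s)) y := ind_compl _ y
      rw [this]; ring
    have e2 := hωap (fun y => κ x (y - s) * ind (fib m ℓ T (x + s)) y)
    have e3 : ω (fun y => κ x (y - s) * ind (fib m ℓ T (x + s)) y) ≤ ω (fun y => κ x (y - s)) :=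
      hωp.mono (hkb.mul hab) hkb
        (fun y => mul_le_of_le_one_right (hk.nonneg _ _) (ind_le_one _ _))
    have e4 : ∑ i ∈ Finset.range q, lam i (fun y => κ x (y - s) * ind (fib m ℓ T (x + s)) y) ≤
        ∑ i ∈ Finset.range q, (ε' + ind (Z i) (x + s) * φ (κ x)
        + (2 / ε0) * φ (fun y => κ x y * d0 q v (x + s) (y + s))) :=
      Finset.sum_le_sum fun i hi => by
        have hi := Finset.mem_range.1 hi
        exact T1_term h hi rfl (hl i hi) (hd i hi) (hbad i hi) hk hε0 hε'p s x
          (fun y => d0_le hv0 hv1 _ _)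
    linarith
  have bQ : Bdd (fun x => φ (fun y => κ x y * d0 q v (x + s) (y + s))) :=
    h.pos.bdd2 (hd0b' s)
  have bi : ∀ i, Bdd (fun x => ε' + ind (Z i) (x + s) * φ (κ x)
        + (2 / ε0) * φ (fun y => κ x y * d0 q v (x + s) (y + s))) := fun i =>
    ((Bdd.const ε').add (((ind_bdd (Z i)).shift s).mul (hk.M_bdd h))).add (bQ.cmul _)
  have b3 : Bdd (fun x => φ (fun y => ind (fib m ℓ Tᶜ (x + s)) y * κ x (y - s))) :=
    h.pos.bdd2 (C := 1) (fun x y => by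
      rw [abs_of_nonneg (mul_nonneg (ind_nonneg _ _) (hk.nonneg _ _))]
      exact mul_le_one₀ (ind_le_one _ _) (hk.nonneg _ _) (hk.le_one _ _))
  have main := h.pos.mono (hk.bdd2 h.pos s)
    (((Bdd.sum (Finset.range q) fun i _ => bi i).add (hk.bdd2 hωp s)).add b3) hpt
  rw [mass_shift h hk, Fn.add, Fn.add, Fn.sum] at main
  have t2 := hτ2 κ r hk s
  have t3 := hτ3 κ r hk s
  have t1 : ∑ i ∈ Finset.range q, φ (fun x => ε' + ind (Z i) (x + s) * φ (κ x)
        + (2 / ε0) * φ (fun y => κ x y * d0 q v (x + s) (y + s))) ≤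
      ∑ i ∈ Finset.range q, (ε' + (ε1 / (q + 1) * N + ε' + τ1 i * r) + (2 / ε0) * (η * N)) := by
    refine Finset.sum_le_sum fun i hi => ?_
    have hi := Finset.mem_range.1 hi
    rw [Fn.add, Fn.add, Fn.cmul, h.cst]
    have a1 := hτ1 i κ r hk s
    have a2 : φ (ind (Z i)) * N ≤ ε1 / (q + 1) * N :=
      mul_le_mul_of_nonneg_right (hZs i hi) (by linarith)
    have a3 : (2 / ε0) * Q s ≤ (2 / ε0) * (η * N) :=
      mul_le_mul_of_nonneg_left hs (by positivity)
    have a4 : φ (fun x => φ (fun y => κ x y * d0 q v (x + s) (y + s))) = Q s := rfl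
    rw [a4]
    linarith
  have t1' : ∑ i ∈ Finset.range q, (ε' + (ε1 / (q + 1) * N + ε' + τ1 i * r) + (2 / ε0) * (η * N))
      = q * ε' * 2 + q * (ε1 / (q + 1)) * N + (∑ i ∈ Finset.range q, (τ1 i : ℝ)) * r
        + q * (2 / ε0 * η) * N := by
    simp only [Finset.sum_add_distrib, Finset.sum_const, Finset.card_range, nsmul_eq_mul,
      Finset.sum_mul]
    ring
  have hqle : (q:ℝ) / (q + 1) ≤ 1 := by rw [div_le_one hQ]; linarith
  have u1 : q * ε' ≤ ε1 * p := by
    have : q * ε' = (ε1 * p) * (q / (q + 1)) := by rw [hε']; ring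
    rw [this]; exact mul_le_of_le_one_right (by positivity) hqle
  have u2 : q * (ε1 / (q + 1)) ≤ ε1 := by
    have : q * (ε1 / (q + 1)) = ε1 * (q / (q + 1)) := by ring
    rw [this]; exact mul_le_of_le_one_right (by positivity) hqle
  have u3 : q * (2 / ε0 * η) ≤ ε1 := by
    have : q * (2 / ε0 * η) = ε1 * (q / (q + 1)) := by rw [hη]; field_simp
    rw [this]; exact mul_le_of_le_one_right (by positivity) hqle
  have hN0 : 0 < N := by linarith
  have w2 := mul_le_mul_of_nonneg_right u2 hN0.le
  have w3 := mul_le_mul_of_nonneg_right u3 hN0.le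
  have w4 : ε1 * p ≤ ε1 * N := by gcongr
  have hτr' : τ * r = (∑ i ∈ Finset.range q, (τ1 i : ℝ)) * r + τ2 * r + τ3 * r := by
    rw [hτ]; ring
  have fin : 1 * N ≤ (ω (fun _ => 1) + R + 7 * ε1) * N := by
    rw [t1'] at t1
    have x3 : R * N = ((m + ℓ : ℕ):ℝ) *
      ((∑ j ∈ Finset.range ℓ, φ (ind (fib m ℓ Tᶜ j))) / ℓ) * mass φ κ := rfl
    rw [← x3] at t3
    have x2 : mass φ κ = N := rfl
    rw [x2] at t2
    nlinarith
  exact le_of_mul_le_mul_right fin hN0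

open Filter Topology

/-- submodule of bounded functions -/
def BdSub : Submodule ℝ (ℤ → ℝ) where
  carrier := {f | Bdd f}
  add_mem' := fun {f g} (hf : Bdd f) (hg : Bdd g) => (hf.add hg : Bdd _)
  zero_mem' := Bdd.const 0
  smul_mem' := fun a f (hf : Bdd f) => (hf.cmul a : Bdd _)

theorem ulim (U : Ultrafilter ℕ) (φ : ℕ → Fn) (hb : ∀ f, Bdd f → ∃ C, ∀ n, |φ n f| ≤ C) :
    ∃ ψ : Fn, ∀ f, Bdd f → Tendsto (fun n => φ n f) U (𝓝 (ψ f)) := by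
  have hex : ∀ f : BdSub, ∃ l : ℝ, Tendsto (fun n => φ n (f : ℤ → ℝ)) U (𝓝 l) := by
    intro f
    obtain ⟨C, hC⟩ := hb f f.2
    have hK : IsCompact (Set.Icc (-C) C) := isCompact_Icc
    obtain ⟨l, _, hl⟩ := hK.ultrafilter_le_nhds (U.map (fun n => φ n (f : ℤ → ℝ))) (by
      rw [le_principal_iff]
      exact mem_map.2 (Filter.Eventually.of_forall fun n => abs_le.1 (hC n)))
    exact ⟨l, hl⟩
  choose l hl using hex
  let L : BdSub →ₗ[ℝ] ℝ :=
    { toFun := l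
      map_add' := fun f g => by
        have h1 := (hl f).add (hl g)
        have h2 := hl (f + g)
        simp only [Submodule.coe_add, map_add] at h2
        exact tendsto_nhds_unique h2 h1
      map_smul' := fun a f => by
        have h1 := (hl f).const_mul a
        have h2 := hl (a • f)
        simp only [Submodule.coe_smul, map_smul, smul_eq_mul] at h2
        exact tendsto_nhds_unique h2 h1 }
  obtain ⟨ψ, hψ⟩ := LinearMap.exists_extend L
  refine ⟨ψ, fun f hf => ?_⟩
  have : ψ f = l ⟨f, hf⟩ := LinearMap.congr_fun hψ ⟨f, hf⟩
  rw [this]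
  exact hl ⟨f, hf⟩

/-- restriction of a functional -/
noncomputable def restr (ω : Fn) (X : Set ℤ) : Fn where
  toFun f := ω (fun x => ind X x * f x)
  map_add' f g := by
    rw [← Fn.add]; congr 1; ext x; simp only [Pi.add_apply]; ring
  map_smul' a f := by
    simp only [RingHom.id_apply, smul_eq_mul]
    rw [← Fn.cmul]; congr 1; ext x; simp only [Pi.smul_apply, smul_eq_mul]; ring

theorem restr_apply (ω : Fn) (X : Set ℤ) (f : ℤ → ℝ) :
    restr ω X f = ω (fun x => ind X x * f x) := rfl

theorem restr_one (ω : Fn) (X : Set ℤ) : restr ω X (fun _ => 1) = ω (ind X) := by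
  rw [restr_apply]; simp

theorem restr_pos {ω : Fn} (h : IsPos ω) (X : Set ℤ) : IsPos (restr ω X) := fun f hf h0 =>
  h _ ((ind_bdd X).mul hf) (fun x => mul_nonneg (ind_nonneg _ _) (h0 x))

theorem restr_dom {ω : Fn} (h : IsPos ω) (X : Set ℤ) : Dom (restr ω X) ω := fun f hf h0 =>
  h.mono ((ind_bdd X).mul hf) hf (fun x => mul_le_of_le_one_left (h0 x) (ind_le_one _ _))

theorem ind_inter (X Y : Set ℤ) : (fun x => ind X x * ind Y x) = ind (X ∩ Y) := by
  ext x
  by_cases hx : x ∈ X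
  · by_cases hy : x ∈ Y
    · rw [ind_mem hx, ind_mem (show x ∈ Y from hy), ind_mem (show x ∈ X ∩ Y from ⟨hx, hy⟩)]; ring
    · rw [ind_mem hx, ind_not_mem (show x ∉ Y from hy), ind_not_mem (show x ∉ X ∩ Y from fun h => hy h.2)]; ring
  · rw [ind_not_mem hx, ind_not_mem (show x ∉ X ∩ Y from fun h => hx h.1)]; ring

theorem exhaust {φ : Fn} (h : IsMean φ) (he : Erg φ) (m ℓ : ℕ) (hℓ : 0 < ℓ) (T D : Set ℤ)
    (hD : ((m + ℓ : ℕ):ℝ) * ((∑ j ∈ Finset.range ℓ, φ (ind (fib m ℓ Tᶜ j))) / ℓ) < φ (ind D)) :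
    ∃ ω : Fn, IsPos ω ∧ Dom ω (restr φ D) ∧ 0 < ω (fun _ => 1) ∧
      ∀ lam, IsPos lam → Dom lam ω → Bad m ℓ T lam → lam (fun _ => 1) ≤ 0 := by
  set R := ((m + ℓ : ℕ):ℝ) * ((∑ j ∈ Finset.range ℓ, φ (ind (fib m ℓ Tᶜ j))) / ℓ) with hR
  have hpick : ∀ ω : Fn, ∃ lam : Fn, IsPos ω → (IsPos lam ∧ Dom lam ω ∧ Bad m ℓ T lam ∧
      ∀ lam', IsPos lam' → Dom lam' ω → Bad m ℓ T lam' →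
        lam' (fun _ => 1) ≤ 2 * lam (fun _ => 1)) := by
    intro ω
    by_cases hω : IsPos ω
    swap
    · exact ⟨0, fun hh => absurd hh hω⟩
    let S : Set ℝ := {a | ∃ lam : Fn, IsPos lam ∧ Dom lam ω ∧ Bad m ℓ T lam ∧
      lam (fun _ => 1) = a}
    have hS0 : (0:ℝ) ∈ S := ⟨0, fun _ _ _ => le_rfl, fun f hf h0 => hω f hf h0,
      fun _ _ => rfl, rfl⟩
    have hbd : BddAbove S := by
      refine ⟨ω (fun _ => 1), ?_⟩
      rintro _ ⟨lam, _, hd, _, rfl⟩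
      exact hd _ (Bdd.const 1) (fun _ => zero_le_one)
    have hs0 : 0 ≤ sSup S := le_csSup hbd hS0
    rcases hs0.eq_or_lt with hs | hs
    · refine ⟨0, fun _ => ⟨fun _ _ _ => le_rfl, fun f hf h0 => hω f hf h0, fun _ _ => rfl, ?_⟩⟩
      intro lam' h1 h2 h3
      have := le_csSup hbd (show lam' (fun _ => 1) ∈ S from ⟨lam', h1, h2, h3, rfl⟩)
      rw [← hs] at this
      simpa using this
    · obtain ⟨_, ⟨lam, h1, h2, h3, rfl⟩, hlt⟩ := exists_lt_of_lt_csSup ⟨0, hS0⟩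
        (show sSup S / 2 < sSup S by linarith)
      refine ⟨lam, fun _ => ⟨h1, h2, h3, fun lam' h1 h2 h3 => ?_⟩⟩
      have := le_csSup hbd (show lam' (fun _ => 1) ∈ S from ⟨lam', h1, h2, h3, rfl⟩)
      linarith
  choose pick hp using hpick
  let w : ℕ → Fn := fun n => Nat.rec (restr φ D) (fun _ ω => ω - pick ω) n
  have w0 : w 0 = restr φ D := rfl
  have ws : ∀ n, w (n + 1) = w n - pick (w n) := fun n => rfl
  have wpos : ∀ n, IsPos (w n) := by
    intro n
    induction n with
    | zero => exact restr_pos h.pos D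
    | succ n ih =>
      intro f hf h0
      rw [ws, LinearMap.sub_apply]
      linarith [(hp (w n) ih).2.1 f hf h0]
  set lam : ℕ → Fn := fun n => pick (w n) with hlam
  have hsumeq : ∀ n f, ∑ i ∈ Finset.range n, lam i f = w 0 f - w n f := by
    intro n f
    induction n with
    | zero => simp
    | succ n ih => rw [Finset.sum_range_succ, ih, ws, LinearMap.sub_apply]; simp only [hlam]; ring
  have hclaim : ∀ n, ∑ i ∈ Finset.range n, lam i (fun _ => 1) ≤ R := by
    intro n
    refine claimA h he m ℓ hℓ T n lam (fun i _ => (hp _ (wpos i)).1)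
      (fun i _ => (hp _ (wpos i)).2.2.1) (fun f hf h0 => ?_)
    rw [hsumeq]
    have a := wpos n f hf h0
    have b : w 0 f ≤ φ f := restr_dom h.pos D f hf h0
    linarith
  have hlow : ∀ n, φ (ind D) - R ≤ w n (fun _ => 1) := by
    intro n
    have a := hclaim n
    rw [hsumeq, w0, restr_one] at a
    linarith
  have hlam0 : ∀ n, 0 ≤ lam n (fun _ => 1) := fun n =>
    (hp _ (wpos n)).1 _ (Bdd.const 1) (fun _ => zero_le_one)
  have hlim : Tendsto (fun n => lam n (fun _ => 1)) atTop (𝓝 0) :=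
    (summable_of_sum_range_le hlam0 hclaim).tendsto_atTop_zero
  have hdec : ∀ n k, n ≤ k → Dom (w k) (w n) := by
    intro n k hnk
    induction k, hnk using Nat.le_induction with
    | base => exact fun f _ _ => le_rfl
    | succ k _ ih =>
      intro f hf h0
      rw [ws, LinearMap.sub_apply]
      linarith [(hp (w k) (wpos k)).1 f hf h0, ih f hf h0]
  set U : Ultrafilter ℕ := Filter.hyperfilter ℕ with hU
  have hUle : (U : Filter ℕ) ≤ atTop := by
    rw [← Nat.cofinite_eq_atTop]; exact Filter.hyperfilter_le_cofinite
  obtain ⟨ω, hω⟩ := ulim U w (fun f hf => by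
    obtain ⟨C, hC⟩ := hf
    have hC0 : 0 ≤ C := (abs_nonneg _).trans (hC 0)
    refine ⟨C * w 0 (fun _ => 1), fun n => ((wpos n).bdd hC).trans ?_⟩
    exact mul_le_mul_of_nonneg_left
      (hdec 0 n (Nat.zero_le _) _ (Bdd.const 1) (fun _ => zero_le_one)) hC0)
  have hωn : ∀ n, Dom ω (w n) := by
    intro n f hf h0
    refine le_of_tendsto (hω f hf) ?_
    exact hUle ((eventually_ge_atTop n).mono fun k hk => hdec n k hk f hf h0)
  refine ⟨ω, ?_, hωn 0, ?_, ?_⟩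
  · intro f hf h0
    exact ge_of_tendsto (hω f hf) (Filter.Eventually.of_forall fun n => wpos n f hf h0)
  · have := ge_of_tendsto (hω _ (Bdd.const 1)) (Filter.Eventually.of_forall hlow)
    linarith
  · intro l' h1 h2 h3
    have h4 : ∀ n, l' (fun _ => 1) ≤ 2 * lam n (fun _ => 1) := fun n =>
      (hp _ (wpos n)).2.2.2 l' h1 (fun f hf h0 => (h2 f hf h0).trans (hωn n f hf h0)) h3
    have h5 := hlim.const_mul 2
    rw [mul_zero] at h5
    exact ge_of_tendsto' h5 h4

theorem build_step {ω : Fn} (hω : IsPos ω) {m ℓ : ℕ} {T D : Set ℤ}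
    (hI : ∀ n, ω (ind (Set.Iic n)) = 0) (hD : ω (ind Dᶜ) = 0)
    (hbad : ∀ lam, IsPos lam → Dom lam ω → Bad m ℓ T lam → lam (fun _ => 1) ≤ 0)
    (X : Set ℤ) (hX : 0 < ω (ind X)) (n : ℤ) :
    ∃ c ∈ X ∩ D, n < c ∧ 0 < ω (ind (X ∩ fib m ℓ T c)) := by
  have h1 : ¬ Bad m ℓ T (restr ω X) := fun hB => by
    have := hbad _ (restr_pos hω X) (restr_dom hω X) hB
    rw [restr_one] at this
    linarith
  unfold Bad at h1
  push Not at h1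
  obtain ⟨ε, hε, hne⟩ := h1
  set W : Set ℤ := {c | ε ≤ val m ℓ T (restr ω X) c} with hW
  rw [restr_apply] at hne
  by_contra hcon
  push Not at hcon
  apply hne
  refine le_antisymm ?_ (hω _ ((ind_bdd X).mul (ind_bdd W))
    (fun x => mul_nonneg (ind_nonneg _ _) (ind_nonneg _ _)))
  have : ω (fun x => ind X x * ind W x) ≤ ω (fun x => ind Dᶜ x + ind (Set.Iic n) x) := by
    refine hω.mono ((ind_bdd X).mul (ind_bdd W)) ((ind_bdd _).add (ind_bdd _)) (fun x => ?_)
    have n1 := ind_nonneg Dᶜ x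
    have n2 := ind_nonneg (Set.Iic n) x
    by_cases hxX : x ∈ X
    swap
    · rw [ind_not_mem hxX]; linarith
    by_cases hxW : x ∈ W
    swap
    · rw [ind_not_mem hxW]; linarith
    rw [ind_mem hxX, ind_mem hxW]
    by_cases hxD : x ∈ D
    swap
    · rw [ind_mem (show x ∈ Dᶜ from hxD)]; linarith
    by_cases hxn : n < x
    swap
    · rw [ind_mem (show x ∈ Set.Iic n from not_lt.1 hxn)]; linarith
    exfalso
    have h2 := hcon x ⟨hxX, hxD⟩ hxn
    have h3 : ε ≤ restr ω X (ind (fib m ℓ T x)) := hxW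
    rw [restr_apply, ind_inter] at h3
    linarith
  rw [Fn.add, hD, hI] at this
  linarith

theorem build {ω : Fn} (hω : IsPos ω) {m ℓ : ℕ} {T D : Set ℤ}
    (hI : ∀ n, ω (ind (Set.Iic n)) = 0) (hD : ω (ind Dᶜ) = 0) (h1 : 0 < ω (fun _ => 1))
    (hbad : ∀ lam, IsPos lam → Dom lam ω → Bad m ℓ T lam → lam (fun _ => 1) ≤ 0) :
    ∃ c : ℕ → ℤ, StrictMono c ∧ (∀ i, 0 < c i) ∧ (∀ i, c i ∈ D) ∧
      ∀ i j, i < j → m * c i + ℓ * c j ∈ T := by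
  choose nx hnx1 hnx2 hnx3 using fun (p : {X : Set ℤ // 0 < ω (ind X)}) (n : ℤ) =>
    build_step hω hI hD hbad p.1 p.2 n
  have hu : 0 < ω (ind Set.univ) := by
    have : ind Set.univ = fun _ => 1 := by ext x; exact ind_mem (Set.mem_univ x)
    rw [this]; exact h1
  let st : ℕ → {X : Set ℤ // 0 < ω (ind X)} × ℤ := fun k => Nat.rec (⟨Set.univ, hu⟩, 0)
    (fun _ p => (⟨p.1.1 ∩ fib m ℓ T (nx p.1 p.2), hnx3 p.1 p.2⟩, nx p.1 p.2)) k
  let c : ℕ → ℤ := fun k => nx (st k).1 (st k).2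
  have st2 : ∀ k, (st (k + 1)).2 = c k := fun k => rfl
  have st1 : ∀ k, (st (k + 1)).1.1 = (st k).1.1 ∩ fib m ℓ T (c k) := fun k => rfl
  have hlt : ∀ k, (st k).2 < c k := fun k => hnx2 _ _
  have hmono : StrictMono c := strictMono_nat_of_lt_succ fun k => by
    have := hlt (k + 1)
    rwa [st2] at this
  have hmem : ∀ k, c k ∈ (st k).1.1 := fun k => (hnx1 _ _).1
  have hsub : ∀ i j, i ≤ j → (st j).1.1 ⊆ (st i).1.1 := by
    intro i j hij
    induction j, hij using Nat.le_induction with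
    | base => exact subset_rfl
    | succ j _ ih => rw [st1]; exact Set.inter_subset_left.trans ih
  refine ⟨c, hmono, fun i => ?_, fun i => (hnx1 _ _).2, fun i j hij => ?_⟩
  · have : (0:ℤ) < c 0 := hlt 0
    exact this.trans_le (hmono.monotone (Nat.zero_le i))
  · have := hsub (i + 1) j hij (hmem j)
    rw [st1] at this
    exact this.2

open Filter Topology

/-- means vanishing on half lines -/
def IsM (φ : Fn) : Prop := IsMean φ ∧ ∀ n : ℤ, φ (ind (Set.Iic n)) = 0

theorem inv_of_one {φ : Fn} (h1 : ∀ f, Bdd f → φ (fun x => f (x + 1)) = φ f) :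
    ∀ f, Bdd f → ∀ t : ℤ, φ (fun x => f (x + t)) = φ f := by
  intro f hf t
  induction t using Int.induction_on with
  | zero => simp
  | succ i ih =>
    rw [← ih, ← h1 (fun x => f (x + i)) (hf.shift i)]
    congr 1; ext x; congr 1; ring
  | pred i ih =>
    rw [← ih, ← h1 (fun x => f (x + (-i - 1))) (hf.shift _)]
    congr 1; ext x; congr 1; ring

theorem avg_mean {φ : Fn} (h : IsMean φ) {f : ℤ → ℝ} (hf : Bdd f) {τ : ℕ} (hτ : 0 < τ) :
    φ (avg τ f) = φ f := by
  have : φ (avg τ f) = (∑ t ∈ Finset.range τ, φ (fun x => f (x + t))) / τ := by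
    rw [← Fn.avg_eq]; rfl
  rw [this, Finset.sum_congr rfl (fun (t:ℕ) _ => h.inv f hf (t:ℤ)), Finset.sum_const, Finset.card_range,
    nsmul_eq_mul]
  have : (0:ℝ) < τ := by exact_mod_cast hτ
  field_simp

theorem avg_nonneg' {f : ℤ → ℝ} (h0 : ∀ x, 0 ≤ f x) (τ : ℕ) (x : ℤ) : 0 ≤ avg τ f x :=
  div_nonneg (Finset.sum_nonneg fun _ _ => h0 _) (Nat.cast_nonneg _)

theorem avg_le_one' {f : ℤ → ℝ} (h1 : ∀ x, f x ≤ 1) (τ : ℕ) (x : ℤ) : avg τ f x ≤ 1 := by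
  rcases Nat.eq_zero_or_pos τ with rfl | hτ
  · simp [avg]
  · exact avg_le_of_le hτ (fun _ _ => h1 _)

/-- symmetric double averages -/
noncomputable def dav (τ : ℕ) (f : ℤ → ℝ) (x : ℤ) : ℝ :=
  (∑ t ∈ Finset.range τ, avg τ f (x - t)) / τ

theorem dav_nonneg {f : ℤ → ℝ} (h0 : ∀ x, 0 ≤ f x) (τ : ℕ) (x : ℤ) : 0 ≤ dav τ f x :=
  div_nonneg (Finset.sum_nonneg fun _ _ => avg_nonneg' h0 _ _) (Nat.cast_nonneg _)

theorem dav_le_one {f : ℤ → ℝ} (h1 : ∀ x, f x ≤ 1) (τ : ℕ) (x : ℤ) : dav τ f x ≤ 1 := by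
  rcases Nat.eq_zero_or_pos τ with rfl | hτ
  · simp [dav]
  · exact avg_le_of_le hτ (fun _ _ => avg_le_one' h1 _ _)

theorem avg_step {f : ℤ → ℝ} (h0 : ∀ x, 0 ≤ f x) (h1 : ∀ x, f x ≤ 1) (τ : ℕ) (x : ℤ) :
    |avg τ f (x + 1) - avg τ f x| ≤ 1 / τ := by
  have a1 := Finset.sum_range_succ (fun s : ℕ => f (x + s)) τ
  have a2 := Finset.sum_range_succ' (fun s : ℕ => f (x + s)) τ
  have a3 : ∑ s ∈ Finset.range τ, f (x + 1 + s) = ∑ s ∈ Finset.range τ, f (x + (s + 1 : ℕ)) :=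
    Finset.sum_congr rfl fun s _ => by congr 1; push_cast; ring
  simp only [avg]
  rw [← sub_div, abs_div, Nat.abs_cast]
  gcongr
  have b1 := h0 (x + τ)
  have b2 := h1 (x + τ)
  have b3 := h0 (x + (0:ℕ))
  have b4 := h1 (x + (0:ℕ))
  rw [abs_le]
  constructor <;> linarith

theorem dav_step {f : ℤ → ℝ} (h0 : ∀ x, 0 ≤ f x) (h1 : ∀ x, f x ≤ 1) (τ : ℕ) (x : ℤ) :
    |dav τ f (x + 1) - dav τ f x| ≤ 1 / τ := by
  rcases Nat.eq_zero_or_pos τ with rfl | hτ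
  · simp [dav]
  have hτ' : (0:ℝ) < τ := by exact_mod_cast hτ
  simp only [dav]
  rw [← sub_div, ← Finset.sum_sub_distrib, abs_div, Nat.abs_cast]
  refine le_trans ?_ (avg_le_of_le hτ (G := fun t : ℕ =>
    |avg τ f (x + 1 - t) - avg τ f (x - t)|) (fun t _ => ?_))
  · gcongr
    exact Finset.abs_sum_le_sum_abs _ _
  · have := avg_step h0 h1 τ (x - t)
    rwa [show x + 1 - (t:ℤ) = x - t + 1 by ring]

/-- multiplication functional -/
noncomputable def mulFn (φ : Fn) (k : ℤ → ℝ) : Fn where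
  toFun f := φ (fun x => f x * k x)
  map_add' f g := by
    rw [← Fn.add]; congr 1; ext x; simp only [Pi.add_apply]; ring
  map_smul' a f := by
    simp only [RingHom.id_apply, smul_eq_mul]
    rw [← Fn.cmul]; congr 1; ext x; simp only [Pi.smul_apply, smul_eq_mul]; ring

theorem ext_lim {φ : Fn} (hφ : IsM φ)
    (hext : ∀ G : Fn, IsM (φ + G) → IsM (φ - G) → ∀ f, Bdd f → G f = 0)
    {f : ℤ → ℝ} (h0 : ∀ x, 0 ≤ f x) (h1 : ∀ x, f x ≤ 1) :
    Tendsto (fun τ : ℕ => φ (fun x => (avg τ f x) ^ 2)) atTop (𝓝 ((φ f) ^ 2)) := by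
  have h := hφ.1
  have hf := Bdd.of01 h0 h1
  rw [tendsto_iff_ultrafilter]
  intro U hU
  have hP : ∀ τ, Bdd (dav τ f) := fun τ => Bdd.of01 (dav_nonneg h0 τ) (dav_le_one h1 τ)
  have hbound : ∀ g : ℤ → ℝ, Bdd g → ∃ C, ∀ τ, |mulFn φ (dav τ f) g| ≤ C := by
    rintro g ⟨C, hC⟩
    refine ⟨C * φ (fun _ => 1), fun τ => h.pos.bdd (f := fun x => g x * dav τ f x) (fun x => ?_)⟩
    rw [abs_mul, abs_of_nonneg (dav_nonneg h0 τ x)]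
    exact (mul_le_of_le_one_right (abs_nonneg _) (dav_le_one h1 τ x)).trans (hC x)
  obtain ⟨ψ, hψ⟩ := ulim U (fun τ => mulFn φ (dav τ f)) hbound
  have hψ' : ∀ g, Bdd g → Tendsto (fun τ => φ (fun x => g x * dav τ f x)) U (𝓝 (ψ g)) := hψ
  set a := φ f with ha
  have ha0 : 0 ≤ a := h.pos f hf h0
  have ha1 : a ≤ 1 := h.le_one hf 1 h1
  have ψpos : ∀ g, Bdd g → (∀ x, 0 ≤ g x) → 0 ≤ ψ g := fun g hg hg0 =>
    ge_of_tendsto' (hψ' g hg) (fun τ => h.pos _ (hg.mul (hP τ))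
      (fun x => mul_nonneg (hg0 x) (dav_nonneg h0 τ x)))
  have ψle : ∀ g, Bdd g → (∀ x, 0 ≤ g x) → ψ g ≤ φ g := fun g hg hg0 =>
    le_of_tendsto' (hψ' g hg) (fun τ => h.pos.mono (hg.mul (hP τ)) hg
      (fun x => mul_le_of_le_one_right (hg0 x) (dav_le_one h1 τ x)))
  have hdavmean : ∀ τ : ℕ, 0 < τ → φ (dav τ f) = a := by
    intro τ hτ
    have : φ (dav τ f) = (∑ t ∈ Finset.range τ, φ (fun x => avg τ f (x - t))) / τ := by
      rw [← Fn.avg_eq]; rfl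
    rw [this, Finset.sum_congr rfl (fun (t:ℕ) _ => h.inv' (hf.avg τ) (t:ℤ)), avg_mean h hf hτ,
      Finset.sum_const, Finset.card_range, nsmul_eq_mul]
    have : (0:ℝ) < τ := by exact_mod_cast hτ
    field_simp
    exact ha.symm
  have ψone : ψ (fun _ => 1) = a := by
    refine tendsto_nhds_unique (hψ' _ (Bdd.const 1)) ?_
    refine tendsto_const_nhds.congr' ?_
    filter_upwards [hU (eventually_gt_atTop 0)] with τ hτ
    simp only [one_mul]
    exact (hdavmean τ hτ).symm
  have ψinv1 : ∀ g, Bdd g → ψ (fun x => g (x + 1)) = ψ g := by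
    rintro g ⟨C, hC⟩
    have hg : Bdd g := ⟨C, hC⟩
    have hC0 : 0 ≤ C := (abs_nonneg _).trans (hC 0)
    have t1 := (hψ' _ (hg.shift 1)).sub (hψ' g hg)
    have t2 : Tendsto (fun τ : ℕ => C * (1 / (τ:ℝ))) U (𝓝 0) := by
      have : Tendsto (fun τ : ℕ => C * (1 / (τ:ℝ))) atTop (𝓝 (C * 0)) :=
        tendsto_one_div_atTop_nhds_zero_nat.const_mul C
      rw [mul_zero] at this
      exact this.mono_left hU
    have t3 : Tendsto (fun τ : ℕ => φ (fun x => g (x + 1) * dav τ f x)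
        - φ (fun x => g x * dav τ f x)) U (𝓝 0) := by
      refine squeeze_zero_norm (fun τ => ?_) t2
      rw [Real.norm_eq_abs, ← h.inv (fun x => g x * dav τ f x) (hg.mul (hP τ)) 1, ← Fn.sub]
      have := h.pos.bdd (f := fun x => g (x + 1) * dav τ f x - g (x + 1) * dav τ f (x + 1))
        (C := C * (1 / (τ:ℝ))) (fun x => by
          rw [← mul_sub, abs_mul, abs_sub_comm]
          exact mul_le_mul (hC _) (dav_step h0 h1 τ x) (abs_nonneg _) hC0)
      rwa [h.one, mul_one] at this
    have := tendsto_nhds_unique t1 t3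
    linarith
  have ψinv := inv_of_one ψinv1
  have ψI : ∀ n : ℤ, ψ (ind (Set.Iic n)) = 0 := fun n =>
    le_antisymm ((ψle _ (ind_bdd _) (ind_nonneg _)).trans_eq (hφ.2 n))
      (ψpos _ (ind_bdd _) (ind_nonneg _))
  set G : Fn := ψ - a • φ with hG
  have Gap : ∀ g, G g = ψ g - a * φ g := fun g => rfl
  have key := hext G
    ⟨⟨fun g hg hg0 => by
        rw [LinearMap.add_apply, Gap]
        nlinarith [ψpos g hg hg0, h.pos g hg hg0],
      by rw [LinearMap.add_apply, Gap, ψone, h.one]; ring,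
      fun g hg t => by
        rw [LinearMap.add_apply, LinearMap.add_apply, Gap, Gap, ψinv g hg t, h.inv g hg t]⟩,
     fun n => by rw [LinearMap.add_apply, Gap, ψI, hφ.2]; ring⟩
    ⟨⟨fun g hg hg0 => by
        rw [LinearMap.sub_apply, Gap]
        nlinarith [ψle g hg hg0, h.pos g hg hg0],
      by rw [LinearMap.sub_apply, Gap, ψone, h.one]; ring,
      fun g hg t => by
        show φ _ - G _ = φ g - G g
        rw [Gap, Gap, ψinv g hg t, h.inv g hg t]⟩,
     fun n => by rw [LinearMap.sub_apply, Gap, ψI, hφ.2]; ring⟩ f hf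
  rw [Gap] at key
  have hlim := hψ' f hf
  have e : ψ f = a ^ 2 := by rw [sq]; linarith
  rw [e] at hlim
  refine hlim.congr fun τ => ?_
  have := avg_move h hf (hf.avg τ) τ 1
  simp only [one_mul] at this
  simp only [sq]
  exact this

theorem ext_erg {φ : Fn} (hφ : IsM φ)
    (hext : ∀ G : Fn, IsM (φ + G) → IsM (φ - G) → ∀ f, Bdd f → G f = 0) : Erg φ := by
  have h := hφ.1
  intro f hf ε hε
  obtain ⟨C, hC⟩ := hf
  have hf : Bdd f := ⟨C, hC⟩
  set B := |C| + 1 with hB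
  have hBp : 0 < B := by positivity
  have hfB : ∀ x, |f x| ≤ B := fun x => (hC x).trans ((le_abs_self C).trans (by linarith))
  set f' : ℤ → ℝ := fun x => (f x + B) / (2 * B) with hf'
  have h0 : ∀ x, 0 ≤ f' x := fun x =>
    div_nonneg (by linarith [(abs_le.1 (hfB x)).1]) (by positivity)
  have h1 : ∀ x, f' x ≤ 1 := fun x => by
    simp only [hf']
    rw [div_le_one (by positivity)]; linarith [(abs_le.1 (hfB x)).2]
  have hfb' := Bdd.of01 h0 h1
  have hff : f = fun x => 2 * B * f' x - B := by
    ext x; simp only [hf']; field_simp; ring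
  have lim := ext_lim hφ hext h0 h1
  have ev := lim.eventually (gt_mem_nhds (show (φ f') ^ 2 < (φ f') ^ 2 + ε / (2 * B) ^ 2 by
    have : 0 < ε / (2 * B) ^ 2 := by positivity
    linarith))
  filter_upwards [ev, eventually_gt_atTop 0] with τ hτ hτ0
  have hτ' : (0:ℝ) < τ := by exact_mod_cast hτ0
  have e1 : φ f = 2 * B * φ f' - B := by
    rw [hff, Fn.sub, Fn.cmul, h.cst]
  have e2 : ∀ x, avg τ f x = 2 * B * avg τ f' x - B := by
    intro x
    simp only [avg, hff]
    rw [Finset.sum_sub_distrib, ← Finset.mul_sum, Finset.sum_const, Finset.card_range,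
      nsmul_eq_mul]
    field_simp
  have e3 : (fun x => (avg τ f x - φ f) ^ 2) = fun x => (2 * B) ^ 2 *
      (avg τ f' x ^ 2 - (2 * φ f') * avg τ f' x + (φ f') ^ 2) := by
    ext x; rw [e1, e2]; ring
  have e4 : φ (fun x => (2 * φ f') * avg τ f' x) = (2 * φ f') * φ f' := by
    rw [Fn.cmul, avg_mean h hfb' hτ0]
  rw [e3, Fn.cmul, Fn.add, Fn.sub, e4, h.cst]
  have := mul_le_mul_of_nonneg_left hτ.le (show 0 ≤ (2 * B) ^ 2 by positivity)
  have e5 : (2 * B) ^ 2 * ((φ f') ^ 2 + ε / (2 * B) ^ 2) = (2 * B) ^ 2 * (φ f') ^ 2 + ε := by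
    field_simp
  nlinarith

/-- the compact convex set of means, as functions on bounded functions -/
def KK : Set (BdSub → ℝ) :=
  {F | (∀ f g : BdSub, F (f + g) = F f + F g) ∧ (∀ (a : ℝ) (f : BdSub), F (a • f) = a * F f) ∧
    (∀ f : BdSub, (∀ x, 0 ≤ (f : ℤ → ℝ) x) → 0 ≤ F f) ∧
    (F ⟨fun _ => 1, Bdd.const 1⟩ = 1) ∧
    (∀ (f : BdSub) (t : ℤ), F ⟨fun x => (f : ℤ → ℝ) (x + t), Bdd.shift f.2 t⟩ = F f) ∧
    (∀ n : ℤ, F ⟨ind (Set.Iic n), ind_bdd _⟩ = 0)}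

theorem KK_of {φ : Fn} (h : IsM φ) : (fun f : BdSub => φ f) ∈ KK :=
  ⟨fun f g => by simp, fun a f => by simp, fun f hf => h.1.pos f f.2 hf, h.1.one,
    fun f t => h.1.inv f f.2 t, h.2⟩

theorem of_KK {F : BdSub → ℝ} (h : F ∈ KK) : ∃ φ : Fn, IsM φ ∧ ∀ f : BdSub, F f = φ f := by
  obtain ⟨h1, h2, h3, h4, h5, h6⟩ := h
  let L : BdSub →ₗ[ℝ] ℝ := { toFun := F, map_add' := h1, map_smul' := h2 }
  obtain ⟨φ, hφ⟩ := LinearMap.exists_extend L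
  have key : ∀ f : BdSub, F f = φ f := fun f => (LinearMap.congr_fun hφ f).symm
  refine ⟨φ, ⟨⟨fun f hf h0 => ?_, ?_, fun f hf t => ?_⟩, fun n => ?_⟩, key⟩
  · rw [← key ⟨f, hf⟩]; exact h3 _ h0
  · rw [← key ⟨fun _ => 1, Bdd.const 1⟩]; exact h4
  · rw [← key ⟨f, hf⟩, ← key ⟨fun x => f (x + t), hf.shift t⟩]; exact h5 ⟨f, hf⟩ t
  · rw [← key ⟨_, ind_bdd _⟩]; exact h6 n

theorem KK_compact : IsCompact KK := by
  have hb : ∀ f : BdSub, ∃ C, ∀ x, |(f : ℤ → ℝ) x| ≤ C := fun f => f.2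
  choose C hC using hb
  refine IsCompact.of_isClosed_subset
    (isCompact_univ_pi (fun f : BdSub => isCompact_Icc (a := -C f) (b := C f))) ?_ ?_
  · unfold KK
    simp only [Set.ofPred_and, Set.ofPred_forall]
    refine IsClosed.inter ?_ (IsClosed.inter ?_ (IsClosed.inter ?_ (IsClosed.inter ?_
      (IsClosed.inter ?_ ?_))))
    · exact isClosed_iInter fun f => isClosed_iInter fun g =>
        isClosed_eq (continuous_apply (f + g)) ((continuous_apply f).add (continuous_apply g))
    · exact isClosed_iInter fun f => isClosed_iInter fun g =>
        isClosed_eq (continuous_apply _) (continuous_const.mul (continuous_apply _))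
    · exact isClosed_iInter fun f => isClosed_iInter fun g =>
        isClosed_le continuous_const (continuous_apply _)
    · exact isClosed_eq (continuous_apply _) continuous_const
    · exact isClosed_iInter fun f => isClosed_iInter fun g =>
        isClosed_eq (continuous_apply _) (continuous_apply _)
    · exact isClosed_iInter fun n => isClosed_eq (continuous_apply _) continuous_const
  · intro F hF f _
    obtain ⟨φ, hφ, hFφ⟩ := of_KK hF
    rw [hFφ]
    have := hφ.1.pos.bdd (hC f)
    rw [hφ.1.one, mul_one] at this
    exact abs_le.1 this

theorem exists_erg {φ0 : Fn} (h0 : IsM φ0) {θ : ℤ → ℝ} (hθ : Bdd θ) :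
    ∃ φ : Fn, IsM φ ∧ Erg φ ∧ φ θ ≤ φ0 θ := by
  set th : BdSub := ⟨θ, hθ⟩ with hth
  obtain ⟨F0, hF0, hmin⟩ := KK_compact.exists_isMinOn ⟨_, KK_of h0⟩
    (f := fun F : BdSub → ℝ => F th) (continuous_apply th).continuousOn
  have hmin' : ∀ F ∈ KK, F0 th ≤ F th := fun F hF => hmin hF
  set K' : Set (BdSub → ℝ) := KK ∩ {F | F th ≤ F0 th} with hK'
  have hc : IsCompact K' := KK_compact.inter_right
    (isClosed_le (continuous_apply _) continuous_const)
  obtain ⟨F, hF⟩ := hc.extremePoints_nonempty ⟨F0, hF0, le_refl (F0 th)⟩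
  rw [mem_extremePoints] at hF
  obtain ⟨⟨hFK, hFmin⟩, hFe⟩ := hF
  have hFmin : F th ≤ F0 th := hFmin
  obtain ⟨φ, hφ, hFφ⟩ := of_KK hFK
  refine ⟨φ, hφ, ext_erg hφ (fun G hp hm f hf => ?_), ?_⟩
  · have kp := KK_of hp
    have km := KK_of hm
    have m1 := hmin' _ kp
    have m2 := hmin' _ km
    simp only [LinearMap.add_apply, LinearMap.sub_apply, ← hFφ] at m1 m2
    have := (hFe _ (show (fun f : BdSub => (φ + G) f) ∈ K' from ⟨kp, by
        show (φ + G) (th : ℤ → ℝ) ≤ F0 th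
        rw [LinearMap.add_apply, ← hFφ]; linarith⟩)
      _ (show (fun f : BdSub => (φ - G) f) ∈ K' from ⟨km, by
        show (φ - G) (th : ℤ → ℝ) ≤ F0 th
        rw [LinearMap.sub_apply, ← hFφ]; linarith⟩)
      ⟨1 / 2, 1 / 2, by norm_num, by norm_num, by norm_num, by
        ext f
        simp only [Pi.add_apply, Pi.smul_apply, smul_eq_mul, LinearMap.add_apply,
          LinearMap.sub_apply, hFφ]
        ring⟩).1
    have := congrFun this ⟨f, hf⟩
    rw [hFφ] at this
    simpa using this
  · have := hmin' _ (KK_of h0)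
    have e : F th = φ θ := hFφ th
    rw [← e]
    exact hFmin.trans this

open Filter Topology

/-- Cesaro functionals on `{1, ..., N}` -/
noncomputable def cav (N : ℕ) : Fn where
  toFun f := avg N f 1
  map_add' f g := by
    simp only [avg, Pi.add_apply, Finset.sum_add_distrib, add_div]
  map_smul' a f := by
    simp only [avg, Pi.smul_apply, smul_eq_mul, RingHom.id_apply, ← Finset.mul_sum, mul_div_assoc]

theorem cav_bdd {f : ℤ → ℝ} {C : ℝ} (hC : ∀ x, |f x| ≤ C) (N : ℕ) : |cav N f| ≤ C := by
  have hC0 : 0 ≤ C := (abs_nonneg _).trans (hC 0)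
  rcases Nat.eq_zero_or_pos N with rfl | hN
  · simpa [cav, avg] using hC0
  · rw [abs_le]
    exact ⟨le_avg_of_le hN fun t _ => (abs_le.1 (hC _)).1,
      avg_le_of_le hN fun t _ => (abs_le.1 (hC _)).2⟩

theorem exists_cesaro : ∃ (U : Ultrafilter ℕ) (φ : Fn), (U : Filter ℕ) ≤ atTop ∧ IsM φ ∧
    ∀ f, Bdd f → Tendsto (fun N => avg N f 1) U (𝓝 (φ f)) := by
  have hU : ((hyperfilter ℕ : Ultrafilter ℕ) : Filter ℕ) ≤ atTop := Nat.hyperfilter_le_atTop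
  set U := hyperfilter ℕ
  obtain ⟨φ, hφ⟩ := ulim U cav (fun f ⟨C, hC⟩ => ⟨C, fun N => cav_bdd hC N⟩)
  have hφ' : ∀ f, Bdd f → Tendsto (fun N => avg N f 1) U (𝓝 (φ f)) := hφ
  have small : ∀ C : ℝ, Tendsto (fun N : ℕ => C * (1 / (N:ℝ))) U (𝓝 0) := fun C => by
    have : Tendsto (fun τ : ℕ => C * (1 / (τ:ℝ))) atTop (𝓝 (C * 0)) :=
      tendsto_one_div_atTop_nhds_zero_nat.const_mul C
    rw [mul_zero] at this
    exact this.mono_left hU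
  refine ⟨U, φ, hU, ⟨⟨fun f hf h0 => ?_, ?_, inv_of_one ?_⟩, fun n => ?_⟩, hφ'⟩
  · exact ge_of_tendsto' (hφ' f hf) fun N => avg_nonneg' h0 N 1
  · refine tendsto_nhds_unique (hφ' _ (Bdd.const 1)) (tendsto_const_nhds.congr' ?_)
    filter_upwards [hU (eventually_gt_atTop 0)] with N hN
    have : (0:ℝ) < N := by exact_mod_cast hN
    simp [avg, this.ne']
  · rintro f ⟨C, hC⟩
    have hf : Bdd f := ⟨C, hC⟩
    have t1 := (hφ' _ (hf.shift 1)).sub (hφ' f hf)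
    have t3 : Tendsto (fun N : ℕ => avg N (fun x => f (x + 1)) 1 - avg N f 1) U (𝓝 0) := by
      refine squeeze_zero_norm (fun N => ?_) (small (2 * C))
      have a1 := Finset.sum_range_succ (fun s : ℕ => f (1 + s)) N
      have a2 := Finset.sum_range_succ' (fun s : ℕ => f (1 + s)) N
      have a3 : ∑ s ∈ Finset.range N, f (1 + s + 1) = ∑ s ∈ Finset.range N, f (1 + (s + 1 : ℕ)) :=
        Finset.sum_congr rfl fun s _ => by congr 1
      simp only [avg]
      rw [Real.norm_eq_abs, ← sub_div, abs_div, Nat.abs_cast, mul_one_div]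
      gcongr
      have b1 := abs_le.1 (hC (1 + N))
      have b3 := abs_le.1 (hC (1 + (0:ℕ)))
      rw [abs_le]
      constructor <;> linarith [b1.1, b1.2, b3.1, b3.2]
    have := tendsto_nhds_unique t1 t3
    linarith
  · refine tendsto_nhds_unique (hφ' _ (ind_bdd _)) ?_
    refine squeeze_zero_norm (fun N => ?_) (small (n.toNat : ℝ))
    rw [Real.norm_eq_abs, abs_of_nonneg (avg_nonneg' (ind_nonneg _) _ _), mul_one_div]
    unfold avg
    gcongr
    have hz : ∀ k, ∑ t ∈ Finset.range k, ind (Set.Iic n) (1 + (t:ℤ)) ≤ n.toNat := by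
      intro k
      calc ∑ t ∈ Finset.range k, ind (Set.Iic n) (1 + (t:ℤ))
          ≤ ∑ t ∈ Finset.range k, (if t ∈ Finset.range n.toNat then (1:ℝ) else 0) := by
            refine Finset.sum_le_sum fun t _ => ?_
            split_ifs with h
            · exact ind_le_one _ _
            · rw [ind_not_mem]
              simp only [Finset.mem_range, Set.mem_Iic] at h ⊢
              omega
        _ = (((Finset.range k) ∩ (Finset.range n.toNat)).card : ℝ) := by
            rw [Finset.sum_ite_mem]; simp
        _ ≤ n.toNat := by
            have := Finset.card_le_card (Finset.inter_subset_right (s₁ := Finset.range k)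
              (s₂ := Finset.range n.toNat))
            rw [Finset.card_range] at this
            exact_mod_cast this
    exact hz N

open scoped Classical in
/-- indicator of the complement of `A` -/
noncomputable def kc (A : Set ℕ) (n : ℕ) : ℝ := if n ∈ A then 0 else 1

theorem kc_nonneg (A : Set ℕ) (n : ℕ) : 0 ≤ kc A n := by
  unfold kc; split_ifs <;> norm_num

/-- counting function of the complement -/
noncomputable def cc (A : Set ℕ) (M : ℕ) : ℝ := ∑ n ∈ Finset.Icc 1 M, kc A n

theorem sum_kc_le (A : Set ℕ) {ι : Type*} (s : Finset ι) (v : ι → ℕ) (M : ℕ)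
    (hv : ∀ i ∈ s, v i ∈ Finset.Icc 1 M) (hinj : Set.InjOn v s) :
    ∑ i ∈ s, kc A (v i) ≤ cc A M := by
  classical
  rw [← Finset.sum_image (f := kc A) hinj]
  refine Finset.sum_le_sum_of_subset_of_nonneg ?_ fun _ _ _ => kc_nonneg _ _
  intro n hn
  obtain ⟨i, hi, rfl⟩ := Finset.mem_image.1 hn
  exact hv i hi

open scoped Classical in
theorem cc_eq (A : Set ℕ) (M : ℕ) :
    cc A M = M - (((Finset.Icc 1 M).filter (· ∈ A)).card : ℝ) := by
  have : ∀ n, kc A n = 1 - (if n ∈ A then (1:ℝ) else 0) := fun n => by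
    unfold kc; split_ifs <;> norm_num
  unfold cc
  simp only [this, Finset.sum_sub_distrib, Finset.sum_boole]
  simp

open scoped Classical in
theorem density_bound (A : Set ℕ) (q : ℝ)
    (hA : 1 - q < Filter.liminf
      (fun N : ℕ => (((Finset.Icc 1 N).filter (· ∈ A)).card : ℝ) / N) Filter.atTop) :
    ∃ δ, δ < q ∧ ∀ᶠ M : ℕ in atTop, cc A M ≤ δ * M := by
  obtain ⟨L, hL1, hL2⟩ := exists_between hA
  refine ⟨1 - L, by linarith, ?_⟩
  have hb : IsBoundedUnder (· ≥ ·) atTop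
      (fun N : ℕ => (((Finset.Icc 1 N).filter (· ∈ A)).card : ℝ) / N) :=
    isBoundedUnder_of ⟨0, fun N => by positivity⟩
  filter_upwards [eventually_lt_of_lt_liminf hL2 hb, eventually_gt_atTop 0] with M hM h0
  have h0' : (0:ℝ) < M := by exact_mod_cast h0
  rw [lt_div_iff₀ h0'] at hM
  rw [cc_eq]
  linarith

/-- the rescaled target set -/
def TT (g : ℕ) (A : Set ℕ) : Set ℤ := {n | ((g:ℤ) * n).toNat ∈ A}

theorem TT_ind (g : ℕ) (A : Set ℕ) (X : Set ℤ) (n : ℕ) (x : ℤ) (k : ℤ)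
    (hX : x ∈ X ↔ k ∈ (TT g A)ᶜ) (hk : (g:ℤ) * k = n) : ind X x = kc A n := by
  have : x ∈ X ↔ n ∉ A := by
    rw [hX]; simp only [TT, Set.mem_compl_iff, Set.mem_setOf_eq, hk, Int.toNat_natCast]
  unfold kc
  split_ifs with h
  · exact ind_not_mem (by rw [this]; simpa using h)
  · exact ind_mem (by rw [this]; exact h)

/-- weight function -/
noncomputable def theta (g m ℓ : ℕ) (A : Set ℕ) (b : ℤ) : ℝ :=
  ind {b : ℤ | ((m:ℤ) + ℓ) * b ∈ TT g A}ᶜ b +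
    ((m + ℓ : ℕ) / ℓ : ℝ) * ∑ j ∈ Finset.range ℓ, ind (fib m ℓ (TT g A)ᶜ (j:ℕ)) b

theorem theta_bdd (g m ℓ : ℕ) (A : Set ℕ) : Bdd (theta g m ℓ A) :=
  (ind_bdd _).add (Bdd.cmul _ (Bdd.sum _ fun _ _ => ind_bdd _))

theorem theta_avg {g m ℓ : ℕ} (hg : 0 < g) (hm : 0 < m) (hℓ : 0 < ℓ) (hc : Nat.Coprime m ℓ)
    (A : Set ℕ) {δ : ℝ} (hδ : ∀ᶠ M : ℕ in atTop, cc A M ≤ δ * M) :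
    ∀ᶠ N : ℕ in atTop, avg N (theta g m ℓ A) 1 ≤
      δ * (g * (m + ℓ)) + δ * (g * (m + ℓ)) * (1 + m * (1 / (N:ℝ))) := by
  obtain ⟨M0, hM0⟩ := eventually_atTop.1 hδ
  filter_upwards [eventually_ge_atTop M0, eventually_gt_atTop 0] with N hN hN0
  have hN' : (0:ℝ) < N := by exact_mod_cast hN0
  have hℓ' : (0:ℝ) < ℓ := by exact_mod_cast hℓ
  have s1 : ∑ t ∈ Finset.range N, kc A (g * (m + ℓ) * (1 + t)) ≤ cc A (g * (m + ℓ) * N) := by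
    refine sum_kc_le A _ (fun t => g * (m + ℓ) * (1 + t)) _ (fun t ht => ?_) ?_
    · rw [Finset.mem_range] at ht
      rw [Finset.mem_Icc]
      exact ⟨Nat.succ_le_of_lt (by positivity), Nat.mul_le_mul_left _ (by omega)⟩
    · intro a _ b _ hab
      have := Nat.eq_of_mul_eq_mul_left (show 0 < g * (m + ℓ) by positivity) hab
      omega
  have s2 : ∑ p ∈ Finset.range ℓ ×ˢ Finset.range N, kc A (g * (m * p.1 + ℓ * (1 + p.2))) ≤
      cc A (g * (ℓ * (N + m))) := by
    refine sum_kc_le A _ (fun p : ℕ × ℕ => g * (m * p.1 + ℓ * (1 + p.2))) _ (fun p hp => ?_) ?_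
    · rw [Finset.mem_product, Finset.mem_range, Finset.mem_range] at hp
      rw [Finset.mem_Icc]
      refine ⟨Nat.succ_le_of_lt (by positivity), Nat.mul_le_mul_left _ ?_⟩
      have e1 : m * p.1 ≤ m * ℓ := Nat.mul_le_mul_left _ hp.1.le
      have e2 : ℓ * (1 + p.2) ≤ ℓ * N := Nat.mul_le_mul_left _ (by omega)
      nlinarith
    · rintro ⟨j, b⟩ hp ⟨j', b'⟩ hp' hab
      simp only [Finset.coe_product, Set.mem_prod, Finset.coe_range, Set.mem_Iio] at hp hp'
      have hab := Nat.eq_of_mul_eq_mul_left hg hab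
      simp only at hab
      have hmod : m * j ≡ m * j' [MOD ℓ] := by
        have h1 : (m * j + ℓ * (1 + b)) % ℓ = (m * j' + ℓ * (1 + b')) % ℓ := by rw [hab]
        rwa [Nat.add_mul_mod_self_left, Nat.add_mul_mod_self_left] at h1
      have hj : j ≡ j' [MOD ℓ] := Nat.ModEq.cancel_left_of_coprime
        (by rw [Nat.gcd_comm]; exact hc) hmod
      have hj : j = j' := Nat.ModEq.eq_of_lt_of_lt hj hp.1 hp'.1
      subst hj
      have := Nat.eq_of_mul_eq_mul_left hℓ (Nat.add_left_cancel hab)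
      rw [Prod.mk.injEq]
      exact ⟨rfl, by omega⟩
  have c1 := hM0 (g * (m + ℓ) * N) (hN.trans (Nat.le_mul_of_pos_left _ (by positivity)))
  have c2 := hM0 (g * (ℓ * (N + m))) (by
    have : N + m ≤ ℓ * (N + m) := Nat.le_mul_of_pos_left _ hℓ
    have : ℓ * (N + m) ≤ g * (ℓ * (N + m)) := Nat.le_mul_of_pos_left _ hg
    omega)
  have e : avg N (theta g m ℓ A) 1 = (∑ t ∈ Finset.range N, kc A (g * (m + ℓ) * (1 + t)) +
      ((m + ℓ : ℕ) / ℓ : ℝ) * ∑ p ∈ Finset.range ℓ ×ˢ Finset.range N,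
        kc A (g * (m * p.1 + ℓ * (1 + p.2)))) / N := by
    unfold avg theta
    rw [Finset.sum_add_distrib, ← Finset.mul_sum, Finset.sum_product_right]
    congr 2
    · refine Finset.sum_congr rfl fun t _ => TT_ind g A _ _ _ (((m:ℤ) + ℓ) * (1 + t)) ?_ ?_
      · rfl
      · push_cast; ring
    · congr 1
      refine Finset.sum_congr rfl fun t _ => Finset.sum_congr rfl fun j _ =>
        TT_ind g A _ _ _ ((m:ℤ) * j + ℓ * (1 + t)) ?_ ?_
      · rfl
      · push_cast; ring
  rw [e, div_le_iff₀ hN']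
  have s1' := s1.trans c1
  have s2' := mul_le_mul_of_nonneg_left (s2.trans c2)
    (show 0 ≤ ((m + ℓ : ℕ) / ℓ : ℝ) by positivity)
  refine (add_le_add s1' s2').trans (le_of_eq ?_)
  push_cast
  field_simp

theorem main_coprime {g m ℓ : ℕ} (hg : 0 < g) (hm : 0 < m) (hℓ : 0 < ℓ) (hc : Nat.Coprime m ℓ)
    (A : Set ℕ) {δ : ℝ} (hδ : ∀ᶠ M : ℕ in atTop, cc A M ≤ δ * M)
    (hδ1 : δ * (g * (m + ℓ)) < 1 / 2) :
    ∃ c : ℕ → ℤ, StrictMono c ∧ (∀ i, 0 < c i) ∧ (∀ i, ((m:ℤ) + ℓ) * c i ∈ TT g A) ∧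
      ∀ i j, i < j → (m:ℤ) * c i + ℓ * c j ∈ TT g A := by
  obtain ⟨U, φ0, hU, h0, hlim⟩ := exists_cesaro
  set θ := theta g m ℓ A with hθ
  have hθb : Bdd θ := theta_bdd g m ℓ A
  have b0 : φ0 θ ≤ δ * (g * (m + ℓ)) + δ * (g * (m + ℓ)) * (1 + m * 0) := by
    refine le_of_tendsto_of_tendsto (hlim θ hθb) (Tendsto.mono_left ?_ hU)
      (hU (theta_avg hg hm hℓ hc A hδ))
    exact ((((tendsto_one_div_atTop_nhds_zero_nat (𝕜 := ℝ)).const_mul (m:ℝ)).const_add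
      1).const_mul _).const_add _
  obtain ⟨φ, hφ, he, hle⟩ := exists_erg h0 hθb
  have h1 : φ θ < 1 := by linarith
  set T := TT g A
  set D : Set ℤ := {b : ℤ | ((m:ℤ) + ℓ) * b ∈ T} with hD
  have h2 : φ θ = (1 - φ (ind D)) + ((m + ℓ : ℕ) / ℓ : ℝ) *
      ∑ j ∈ Finset.range ℓ, φ (ind (fib m ℓ Tᶜ (j:ℕ))) := by
    have e1 : φ (ind Dᶜ) = 1 - φ (ind D) := by
      rw [show ind Dᶜ = fun x => 1 - ind D x from funext (ind_compl D), Fn.sub, hφ.1.one]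
    rw [← e1, ← Fn.sum, ← Fn.cmul, ← Fn.add]
    rfl
  obtain ⟨ω, w1, w2, w3, w4⟩ := exhaust hφ.1 he m ℓ hℓ T D (by
    rw [← mul_div_assoc, mul_div_right_comm]; linarith)
  have wle : ∀ f, Bdd f → (∀ x, 0 ≤ f x) → ω f ≤ φ f := fun f hf hf0 =>
    (w2 f hf hf0).trans (restr_dom hφ.1.pos D f hf hf0)
  refine build w1 (T := T) (D := D) (fun n => ?_) ?_ w3 w4
  · exact le_antisymm ((wle _ (ind_bdd _) (ind_nonneg _)).trans_eq (hφ.2 n))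
      (w1 _ (ind_bdd _) (ind_nonneg _))
  · refine le_antisymm ((w2 _ (ind_bdd _) (ind_nonneg _)).trans_eq ?_)
      (w1 _ (ind_bdd _) (ind_nonneg _))
    rw [restr_apply, show (fun x => ind D x * ind Dᶜ x) = fun _ => (0:ℝ) from funext fun x => by
      by_cases h : x ∈ D
      · rw [ind_not_mem (X := Dᶜ) (by simpa using h), mul_zero]
      · rw [ind_not_mem h, zero_mul]]
    exact map_zero φ

theorem main_final (ℓ m : ℕ) (hℓ : 0 < ℓ) (hm : 0 < m)
    (A : Set ℕ) {δ : ℝ} (hδ : ∀ᶠ M : ℕ in atTop, cc A M ≤ δ * M)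
    (hδ1 : δ < 1 / (2 * ((ℓ : ℝ) + m))) :
    ∃ B : Set ℕ, B.Infinite ∧
      ∀ b₁ ∈ B, ∀ b₂ ∈ B, b₁ ≤ b₂ → m * b₁ + ℓ * b₂ ∈ A := by
  obtain ⟨m1, ℓ1, hc, hm1, hℓ1⟩ := Nat.exists_coprime m ℓ
  set g := m.gcd ℓ with hgdef
  have hg : 0 < g := Nat.gcd_pos_of_pos_left _ hm
  have hm1' : 0 < m1 := Nat.pos_of_ne_zero (by rintro rfl; omega)
  have hℓ1' : 0 < ℓ1 := Nat.pos_of_ne_zero (by rintro rfl; omega)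
  have hmR : (m:ℝ) = m1 * g := by exact_mod_cast hm1
  have hℓR : (ℓ:ℝ) = ℓ1 * g := by exact_mod_cast hℓ1
  have hmZ : (m:ℤ) = m1 * g := by exact_mod_cast hm1
  have hℓZ : (ℓ:ℤ) = ℓ1 * g := by exact_mod_cast hℓ1
  have hpos : (0:ℝ) < ℓ + m := by positivity
  obtain ⟨c, cmono, cpos, cD, cT⟩ := main_coprime hg hm1' hℓ1' hc A hδ (by
    rw [lt_div_iff₀ (by positivity)] at hδ1
    rw [hmR, hℓR] at hδ1
    linarith)
  have key : ∀ i j, i ≤ j → (m1:ℤ) * c i + ℓ1 * c j ∈ TT g A := by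
    intro i j hij
    rcases hij.eq_or_lt with rfl | h
    · rw [← add_mul]; exact cD i
    · exact cT i j h
  refine ⟨Set.range fun i => (c i).toNat, Set.infinite_range_of_injective ?_, ?_⟩
  · intro i j hij
    apply cmono.injective
    have := cpos i
    have := cpos j
    simp only at hij
    omega
  · rintro _ ⟨i, rfl⟩ _ ⟨j, rfl⟩ hij
    have pi := cpos i
    have pj := cpos j
    have hij : i ≤ j := cmono.le_iff_le.1 (by simp only at hij; omega)
    have := key i j hij
    simp only [TT, Set.mem_setOf_eq] at this
    convert this using 1
    have e1 : ((c i).toNat : ℤ) = c i := Int.toNat_of_nonneg pi.le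
    have e2 : ((c j).toNat : ℤ) = c j := Int.toNat_of_nonneg pj.le
    have : (((m * (c i).toNat + ℓ * (c j).toNat : ℕ)) : ℤ) = g * (m1 * c i + ℓ1 * c j) := by
      push_cast
      rw [e1, e2, hmZ, hℓZ]; ring
    rw [← this, Int.toNat_natCast]

/-- If `d_(A) > 1 - 1/(2(ℓ+m))`, there exists an infinite `B ⊆ ℕ` with
`{m b₁ + ℓ b₂ : b₁, b₂ ∈ B, b₁ ≤ b₂} ⊆ A`. -/
theorem mB_add_lB_diag_lowerDensity_unshifted (ℓ m : ℕ) (hℓ : 0 < ℓ) (hm : 0 < m)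
    (A : Set ℕ) (hA : lowerDensity A > 1 - 1 / (2 * ((ℓ : ℝ) + m))) :
    ∃ B : Set ℕ, B.Infinite ∧
      ∀ b₁ ∈ B, ∀ b₂ ∈ B, b₁ ≤ b₂ → m * b₁ + ℓ * b₂ ∈ A := by
  obtain ⟨δ, h1, h2⟩ := density_bound A (1 / (2 * ((ℓ : ℝ) + m))) hA
  exact main_final ℓ m hℓ hm A h2 h1
end

section
/- Let ℓ, m be positive integers. There exist sets A, A' ⊆ ℕ with lower density d_(A) = 1/2 and d_(A') = 1 − 1/(2(ℓ+m)) such that for every infinite set B ⊆ ℕ and every positive integer t, the set {m·b₁ + ℓ·b₂ : b₁, b₂ ∈ B and b₁ ≤ b₂} + t is not contained in A, and the set {m·b₁ + ℓ·b₂ : b₁, b₂ ∈ B and b₁ ≤ b₂} is not contained in A'. -/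
open Filter MeasureTheory Topology

open scoped Classical in
/-- Indicator of a set of naturals, real valued. -/
noncomputable def chiInd (A : Set ℕ) (n : ℕ) : ℝ := if n ∈ A then 1 else 0

lemma chiInd_nonneg (A : Set ℕ) (n : ℕ) : 0 ≤ chiInd A n := by
  unfold chiInd; split_ifs <;> norm_num

lemma chiInd_le_one (A : Set ℕ) (n : ℕ) : chiInd A n ≤ 1 := by
  unfold chiInd; split_ifs <;> norm_num

open scoped Classical in
lemma card_eq_sum_chiInd (A : Set ℕ) (s : Finset ℕ) :
    ((s.filter (· ∈ A)).card : ℝ) = ∑ n ∈ s, chiInd A n := by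
  simp [chiInd, Finset.sum_ite]

lemma sum_shift_sub (A : Set ℕ) (N i : ℕ) :
    ∑ n ∈ Finset.Icc 1 N, chiInd A (n + (i + 1)) - ∑ n ∈ Finset.Icc 1 N, chiInd A (n + i)
      = chiInd A (N + 1 + i) - chiInd A (1 + i) := by
  induction N with
  | zero => simp
  | succ N ih =>
    rw [Finset.sum_Icc_succ_top (by omega), Finset.sum_Icc_succ_top (by omega)]
    have : N + 1 + (i + 1) = N + 1 + 1 + i := by ring
    rw [this]
    linarith

lemma sum_shift_le (A : Set ℕ) (N i : ℕ) :
    |∑ n ∈ Finset.Icc 1 N, chiInd A (n + i) - ∑ n ∈ Finset.Icc 1 N, chiInd A n| ≤ i := by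
  induction i with
  | zero => simp
  | succ i ih =>
    have h := sum_shift_sub A N i
    have h1 := chiInd_nonneg A (N + 1 + i)
    have h2 := chiInd_le_one A (N + 1 + i)
    have h3 := chiInd_nonneg A (1 + i)
    have h4 := chiInd_le_one A (1 + i)
    rw [abs_le] at ih ⊢
    push_cast
    constructor <;> linarith [ih.1, ih.2]

open scoped Classical in
lemma window_bound (A E : Set ℕ) (L : ℕ) (c : ℝ) (hc0 : 0 ≤ c) (hcL : c ≤ L)
    (hE : ∀ n, n ∉ E → ∑ i ∈ Finset.range L, chiInd A (n + i) = c) (N : ℕ) :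
    |(L : ℝ) * ∑ n ∈ Finset.Icc 1 N, chiInd A n - c * N|
      ≤ (L : ℝ) * L + L * ((Finset.Icc 1 N).filter (· ∈ E)).card := by
  set F := ∑ n ∈ Finset.Icc 1 N, chiInd A n with hF
  have h1 : |∑ i ∈ Finset.range L, ((∑ n ∈ Finset.Icc 1 N, chiInd A (n + i)) - F)|
      ≤ (L : ℝ) * L := by
    refine (Finset.abs_sum_le_sum_abs _ _).trans ?_
    calc _ ≤ ∑ i ∈ Finset.range L, (L : ℝ) := by
          refine Finset.sum_le_sum fun i hi => (sum_shift_le A N i).trans ?_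
          have := Finset.mem_range.1 hi
          exact_mod_cast this.le
      _ = _ := by simp
  have h2 : |∑ n ∈ Finset.Icc 1 N, ((∑ i ∈ Finset.range L, chiInd A (n + i)) - c)|
      ≤ L * ((Finset.Icc 1 N).filter (· ∈ E)).card := by
    refine (Finset.abs_sum_le_sum_abs _ _).trans ?_
    rw [card_eq_sum_chiInd, Finset.mul_sum]
    refine Finset.sum_le_sum fun n _ => ?_
    by_cases hn : n ∈ E
    · have a1 : 0 ≤ ∑ i ∈ Finset.range L, chiInd A (n + i) :=
        Finset.sum_nonneg fun i _ => chiInd_nonneg _ _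
      have a2 : ∑ i ∈ Finset.range L, chiInd A (n + i) ≤ L := by
        calc _ ≤ ∑ i ∈ Finset.range L, (1 : ℝ) :=
              Finset.sum_le_sum fun i _ => chiInd_le_one _ _
          _ = _ := by simp
      have : chiInd E n = 1 := by simp [chiInd, hn]
      rw [this, abs_le]
      constructor <;> linarith
    · rw [hE n hn]
      simp [chiInd, hn]
  rw [Finset.sum_sub_distrib, Finset.sum_comm] at h1
  rw [Finset.sum_sub_distrib] at h2
  simp only [Finset.sum_const, Finset.card_range, Nat.card_Icc, nsmul_eq_mul,
    Nat.add_sub_cancel] at h1 h2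
  rw [abs_le] at *
  constructor <;> linarith [h1.1, h1.2, h2.1, h2.2]

open scoped Classical in
lemma lowerDensity_of_window (A E : Set ℕ) (L : ℕ) (hL : 0 < L) (c : ℝ) (hc0 : 0 ≤ c)
    (hcL : c ≤ L)
    (hE : ∀ n, n ∉ E → ∑ i ∈ Finset.range L, chiInd A (n + i) = c)
    (hE0 : Tendsto (fun N : ℕ => (((Finset.Icc 1 N).filter (· ∈ E)).card : ℝ) / N) atTop (𝓝 0)) :
    lowerDensity A = c / L := by
  unfold lowerDensity
  apply Tendsto.liminf_eq
  have hlim : Tendsto (fun N : ℕ => (L : ℝ) / N +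
      (((Finset.Icc 1 N).filter (· ∈ E)).card : ℝ) / N) atTop (𝓝 0) := by
    simpa using (tendsto_const_div_atTop_nhds_zero_nat (L : ℝ)).add hE0
  rw [tendsto_iff_norm_sub_tendsto_zero]
  refine squeeze_zero' (Eventually.of_forall fun _ => norm_nonneg _) ?_ hlim
  filter_upwards [eventually_gt_atTop 0] with N hN
  have hw := window_bound A E L c hc0 hcL hE N
  rw [card_eq_sum_chiInd A]
  have hN' : (0 : ℝ) < N := by exact_mod_cast hN
  have hL' : (0 : ℝ) < L := by exact_mod_cast hL
  rw [Real.norm_eq_abs]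
  have e : (∑ n ∈ Finset.Icc 1 N, chiInd A n) / N - c / L
      = (L * ∑ n ∈ Finset.Icc 1 N, chiInd A n - c * N) / (L * N) := by
    field_simp
  rw [e, abs_div, abs_of_pos (mul_pos hL' hN'), div_le_iff₀ (mul_pos hL' hN')]
  refine hw.trans (le_of_eq ?_)
  field_simp

/-- breakpoints -/
noncomputable def brk (r : ℝ) (k : ℕ) : ℕ := ⌈r ^ k⌉₊

lemma brk_mono {r : ℝ} (hr : 1 < r) : Monotone (brk r) := fun _ _ h =>
  Nat.ceil_mono (pow_le_pow_right₀ hr.le h)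

/-- The main set. -/
def goodSet (r : ℝ) (q : ℕ) : Set ℕ :=
  {n | q ∣ n → ∃ k, (n / q) % 2 = k % 2 ∧ brk r k + k ≤ n ∧ n + k < brk r (k + 1)}

/-- Exceptional set. -/
def excSet (r : ℝ) (L : ℕ) : Set ℕ :=
  {n | ¬ ∃ k, brk r k + k ≤ n ∧ n + L + k < brk r (k + 1)}

lemma brk_unique {r : ℝ} (hr : 1 < r) {n k k' : ℕ} (h1 : brk r k ≤ n) (h2 : n < brk r (k + 1))
    (h1' : brk r k' ≤ n) (h2' : n < brk r (k' + 1)) : k = k' := by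
  rcases lt_trichotomy k k' with h | h | h
  · have := brk_mono hr (show k + 1 ≤ k' from h)
    omega
  · exact h
  · have := brk_mono hr (show k' + 1 ≤ k from h)
    omega

open scoped Classical in
lemma exc_card (r : ℝ) (hr : 1 < r) (L N K : ℕ) (hK : (N : ℝ) < r ^ (K + 1)) :
    ((Finset.Icc 1 N).filter (· ∈ excSet r L)).card ≤ (K + 1) * (2 * K + L + 1) := by
  have hsub : (Finset.Icc 1 N).filter (· ∈ excSet r L) ⊆
      (Finset.range (K + 1)).biUnion fun k =>
        Finset.Ico (brk r k) (brk r k + k) ∪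
          Finset.Ico (brk r (k + 1) - (L + k)) (brk r (k + 1)) := by
    intro n hn
    simp only [Finset.mem_filter, Finset.mem_Icc] at hn
    obtain ⟨⟨hn1, hnN⟩, hne⟩ := hn
    have hex : ∃ k, n < brk r (k + 1) := ⟨K, by
      unfold brk
      rw [Nat.lt_ceil]
      exact lt_of_le_of_lt (by exact_mod_cast hnN) hK⟩
    let k := Nat.find hex
    have hk : n < brk r (k + 1) := Nat.find_spec hex
    have hkK : k ≤ K := Nat.find_min' hex (by
      unfold brk
      rw [Nat.lt_ceil]
      exact lt_of_le_of_lt (by exact_mod_cast hnN) hK)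
    have hk0 : brk r k ≤ n := by
      rcases Nat.eq_zero_or_pos k with h | h
      · rw [h]; simpa [brk] using hn1
      · have := Nat.find_min hex (show k - 1 < k by omega)
        rw [Nat.sub_add_cancel h] at this
        omega
    simp only [Finset.mem_biUnion, Finset.mem_range, Finset.mem_union, Finset.mem_Ico]
    refine ⟨k, by omega, ?_⟩
    by_contra hcon
    apply hne
    refine ⟨k, ?_, ?_⟩ <;> omega
  refine (Finset.card_le_card hsub).trans (Finset.card_biUnion_le.trans ?_)
  calc _ ≤ ∑ k ∈ Finset.range (K + 1), (2 * K + L + 1) := by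
        refine Finset.sum_le_sum fun k hk => (Finset.card_union_le _ _).trans ?_
        have := Finset.mem_range.1 hk
        simp only [Nat.card_Ico]
        omega
    _ = _ := by simp

open scoped Classical in
lemma exc_density (r : ℝ) (hr : 1 < r) (L : ℕ) :
    Tendsto (fun N : ℕ => (((Finset.Icc 1 N).filter (· ∈ excSet r L)).card : ℝ) / N)
      atTop (𝓝 0) := by
  have h0 : Tendsto (fun K : ℕ => (((K + 1) * (2 * K + L + 1) : ℕ) : ℝ) / r ^ K) atTop (𝓝 0) := by
    have a2 := tendsto_pow_const_div_const_pow_of_one_lt 2 hr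
    have a1 := tendsto_pow_const_div_const_pow_of_one_lt 1 hr
    have a0 := tendsto_pow_const_div_const_pow_of_one_lt 0 hr
    have := ((a2.const_mul 2).add (a1.const_mul ((L : ℝ) + 3))).add (a0.const_mul ((L : ℝ) + 1))
    simp only [mul_zero, add_zero] at this
    refine this.congr fun K => ?_
    push_cast
    ring
  have hlog : Tendsto (fun N : ℕ => ⌊Real.logb r N⌋₊) atTop atTop :=
    tendsto_nat_floor_atTop.comp ((Real.tendsto_logb_atTop hr).comp tendsto_natCast_atTop_atTop)
  refine squeeze_zero' (Eventually.of_forall fun _ => by positivity) ?_ (h0.comp hlog)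
  filter_upwards [eventually_gt_atTop 0] with N hN
  have hN' : (0 : ℝ) < N := by exact_mod_cast hN
  have hN1 : (1 : ℝ) ≤ N := by exact_mod_cast hN
  simp only [Function.comp]
  set K := ⌊Real.logb r N⌋₊ with hKdef
  have hlow : r ^ K ≤ N := by
    rw [← Real.rpow_natCast, ← Real.le_logb_iff_rpow_le hr hN']
    exact Nat.floor_le (Real.logb_nonneg hr hN1)
  have hup : (N : ℝ) < r ^ (K + 1) := by
    rw [← Real.rpow_natCast, ← Real.logb_lt_iff_lt_rpow hr hN']
    push_cast
    exact Nat.lt_floor_add_one _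
  have hrK : 0 < r ^ K := pow_pos (by linarith) _
  gcongr
  exact exc_card r hr L N K hup

lemma good_window (r : ℝ) (hr : 1 < r) (q : ℕ) (hq : 0 < q) (n : ℕ)
    (hn : n ∉ excSet r (2 * q)) :
    ∑ i ∈ Finset.range (2 * q), chiInd (goodSet r q) (n + i) = 2 * q - 1 := by
  classical
  simp only [excSet, Set.mem_ofPred_eq, not_not] at hn
  obtain ⟨k, hk1, hk2⟩ := hn
  have key : ∀ i ∈ Finset.range (2 * q), chiInd (goodSet r q) (n + i)
      = 1 - (if n + i ≡ q * (k + 1) [MOD 2 * q] then 1 else 0) := by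
    intro i hi
    rw [Finset.mem_range] at hi
    have hiff : n + i ∈ goodSet r q ↔ ¬ (n + i ≡ q * (k + 1) [MOD 2 * q]) := by
      by_cases hd : q ∣ n + i
      · obtain ⟨s, hs⟩ := hd
        have hmod : n + i ≡ q * (k + 1) [MOD 2 * q] ↔ s % 2 = (k + 1) % 2 := by
          rw [hs, mul_comm 2 q]
          exact Nat.ModEq.mul_left_cancel_iff' hq.ne'
        have hdiv : (n + i) / q = s := by rw [hs]; exact Nat.mul_div_cancel_left s hq
        rw [hmod]
        constructor
        · intro h
          obtain ⟨k', h1, h2, h3⟩ := h ⟨s, hs⟩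
          have : k = k' := brk_unique hr (n := n + i) (by omega) (by omega) (by omega) (by omega)
          rw [hdiv] at h1
          omega
        · intro h _
          refine ⟨k, ?_, by omega, by omega⟩
          rw [hdiv]
          omega
      · have h1 : n + i ∈ goodSet r q := fun h => absurd h hd
        refine iff_of_true h1 fun h => hd ?_
        have h2 : n + i ≡ q * (k + 1) [MOD q] := h.of_mul_left 2
        exact (h2.dvd_iff dvd_rfl).2 (dvd_mul_right _ _)
    unfold chiInd
    by_cases h : n + i ≡ q * (k + 1) [MOD 2 * q]
    · rw [if_pos h, if_neg (fun h' => hiff.1 h' h)]; norm_num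
    · rw [if_neg h, if_pos (hiff.2 h)]; norm_num
  rw [Finset.sum_congr rfl key, Finset.sum_sub_distrib]
  have hcount : ∑ i ∈ Finset.range (2 * q),
      (if n + i ≡ q * (k + 1) [MOD 2 * q] then (1 : ℝ) else 0) = 1 := by
    have h1 := Nat.filter_Ico_card_eq_of_periodic n (2 * q)
      (fun x => x ≡ q * (k + 1) [MOD 2 * q]) (fun x => by simp [Nat.ModEq])
    have h2 : (2 * q).count (fun x => x ≡ q * (k + 1) [MOD 2 * q]) = 1 := by
      rw [Nat.count_modEq_card _ (by omega)]
      simp [Nat.div_self (show 0 < 2 * q by omega)]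
    rw [h2] at h1
    have h3 := Finset.sum_Ico_eq_sum_range
      (fun x => if x ≡ q * (k + 1) [MOD 2 * q] then (1 : ℝ) else 0) n (n + 2 * q)
    rw [Nat.add_sub_cancel_left] at h3
    rw [← h3, Finset.sum_boole, h1]
    norm_num
  rw [hcount]
  simp

lemma good_density (r : ℝ) (hr : 1 < r) (q : ℕ) (hq : 0 < q) :
    lowerDensity (goodSet r q) = 1 - 1 / (2 * (q : ℝ)) := by
  have hq1 : (1 : ℝ) ≤ q := by exact_mod_cast hq
  rw [lowerDensity_of_window (goodSet r q) (excSet r (2 * q)) (2 * q) (by omega) (2 * q - 1)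
    (by linarith) (by push_cast; linarith) (good_window r hr q hq) (exc_density r hr _)]
  push_cast
  field_simp

lemma good_avoid (ℓ m : ℕ) (hℓ : 0 < ℓ) (hm : 0 < m) (q : ℕ) (hq : 0 < q) (hqd : q ∣ ℓ + m)
    (t : ℕ) (ht : q ∣ t) (B : Set ℕ) (hB : B.Infinite) :
    ¬ (∀ b₁ ∈ B, ∀ b₂ ∈ B, b₁ ≤ b₂ →
      m * b₁ + ℓ * b₂ + t ∈ goodSet (((ℓ : ℝ) + m) / ℓ) q) := by
  intro h
  set r : ℝ := ((ℓ : ℝ) + m) / ℓ with hrdef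
  have hℓ' : (0 : ℝ) < ℓ := by exact_mod_cast hℓ
  have hm' : (0 : ℝ) < m := by exact_mod_cast hm
  have hr : 1 < r := by rw [hrdef, one_lt_div hℓ']; linarith
  -- a residue class hit infinitely often
  obtain ⟨v, hv⟩ : ∃ v, (B ∩ {b | b % (2 * q) = v}).Infinite := by
    by_contra hcon
    push Not at hcon
    apply hB
    have : B ⊆ ⋃ v ∈ Finset.range (2 * q), (B ∩ {b | b % (2 * q) = v}) := by
      intro b hb
      simp only [Set.mem_iUnion, Finset.mem_range]
      exact ⟨b % (2 * q), Nat.mod_lt _ (by omega), hb, rfl⟩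
    refine Set.Finite.subset ?_ this
    exact Set.Finite.biUnion (Finset.finite_toSet _) fun v _ => Set.not_infinite.1 (by
      simpa using hcon v)
  obtain ⟨b₁, hb₁, hv₁⟩ := hv.nonempty
  set c := m * b₁ + t with hc
  obtain ⟨b, ⟨hb, hvb⟩, hbig⟩ := hv.exists_gt (b₁ + brk r (c + 1))
  have hmodb : b₁ ≡ b [MOD 2 * q] := by
    simp only [Set.mem_ofPred_eq] at hv₁ hvb
    exact hv₁.trans hvb.symm
  have H2 := h b₁ hb₁ b hb (by omega)
  have H1 := h b hb b hb le_rfl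
  have hmod : m * b₁ + ℓ * b + t ≡ m * b + ℓ * b + t [MOD 2 * q] :=
    ((hmodb.mul_left m).add_right _).add_right _
  have hd1 : q ∣ m * b + ℓ * b + t := by
    refine dvd_add ?_ ht
    rw [← add_mul, add_comm m]
    exact hqd.mul_right _
  have hd2 : q ∣ m * b₁ + ℓ * b + t :=
    ((hmod.of_mul_left 2).dvd_iff dvd_rfl).2 hd1
  obtain ⟨k', p1, l1, u1⟩ := H1 hd1
  obtain ⟨k, p2, l2, u2⟩ := H2 hd2
  have hpar : (m * b + ℓ * b + t) / q % 2 = (m * b₁ + ℓ * b + t) / q % 2 := by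
    obtain ⟨x, hx⟩ := hd1
    obtain ⟨y, hy⟩ := hd2
    rw [hx, hy] at hmod ⊢
    rw [Nat.mul_div_cancel_left _ hq, Nat.mul_div_cancel_left _ hq]
    rw [mul_comm 2 q] at hmod
    exact ((Nat.ModEq.mul_left_cancel_iff' hq.ne').1 hmod).symm
  have hlb : b ≤ ℓ * b := Nat.le_mul_of_pos_left b hℓ
  have hkc : c ≤ k := by
    by_contra hlt
    have := brk_mono hr (show k + 1 ≤ c + 1 by omega)
    omega
  -- real versions
  have L2 : r ^ k + k ≤ ℓ * b + c := by
    have e1 : r ^ k ≤ (brk r k : ℝ) := Nat.le_ceil _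
    have e2 : ((brk r k + k : ℕ) : ℝ) ≤ ((ℓ * b + c : ℕ) : ℝ) := by
      exact_mod_cast (by omega : brk r k + k ≤ ℓ * b + c)
    push_cast at e2
    linarith
  have U2 : (ℓ : ℝ) * b + c + k < r ^ (k + 1) := by
    have : ℓ * b + c + k < brk r (k + 1) := by omega
    unfold brk at this
    rw [Nat.lt_ceil] at this
    exact_mod_cast this
  have hn1 : ((m * b + ℓ * b + t : ℕ) : ℝ) = r * (ℓ * b) + t := by
    push_cast
    rw [hrdef]
    field_simp
    ring
  have hkc' : (c : ℝ) ≤ k := by exact_mod_cast hkc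
  have htc : (t : ℝ) ≤ c := by exact_mod_cast (by omega : t ≤ c)
  have ht0 : (0 : ℝ) ≤ t := Nat.cast_nonneg t
  have L1 : brk r (k + 1) ≤ m * b + ℓ * b + t := by
    unfold brk
    rw [Nat.ceil_le, hn1, pow_succ]
    nlinarith
  have U1 : m * b + ℓ * b + t < brk r (k + 1 + 1) := by
    unfold brk
    rw [Nat.lt_ceil, hn1, pow_succ]
    have : (ℓ : ℝ) * b + t < r ^ (k + 1) := by linarith
    nlinarith
  have hk : k + 1 = k' := brk_unique hr L1 U1 (by omega) (by omega)
  omega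

/-- **Optimality of the lower density thresholds.** There are sets `A, A' ⊆ ℕ` with
`d_(A) = 1/2` and `d_(A') = 1 - 1/(2(ℓ+m))` such that no shifted (resp. unshifted) sumset
`{m b₁ + ℓ b₂ : b₁ ≤ b₂ ∈ B}` over an infinite `B` is contained in `A` (resp. `A'`). -/
theorem optimality_lowerDensity (ℓ m : ℕ) (hℓ : 0 < ℓ) (hm : 0 < m) :
    ∃ A A' : Set ℕ,
      lowerDensity A = 1 / 2 ∧
      lowerDensity A' = 1 - 1 / (2 * ((ℓ : ℝ) + m)) ∧
      ∀ B : Set ℕ, B.Infinite →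
        (∀ t : ℕ, 0 < t →
          ¬ (∀ b₁ ∈ B, ∀ b₂ ∈ B, b₁ ≤ b₂ → m * b₁ + ℓ * b₂ + t ∈ A)) ∧
        ¬ (∀ b₁ ∈ B, ∀ b₂ ∈ B, b₁ ≤ b₂ → m * b₁ + ℓ * b₂ ∈ A') := by
  have hℓ' : (0 : ℝ) < ℓ := by exact_mod_cast hℓ
  have hm' : (0 : ℝ) < m := by exact_mod_cast hm
  have hr : 1 < ((ℓ : ℝ) + m) / ℓ := by rw [one_lt_div hℓ']; linarith
  refine ⟨goodSet (((ℓ : ℝ) + m) / ℓ) 1, goodSet (((ℓ : ℝ) + m) / ℓ) (ℓ + m), ?_, ?_, ?_⟩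
  · rw [good_density _ hr 1 one_pos]; norm_num
  · rw [good_density _ hr (ℓ + m) (by omega)]; push_cast; rfl
  · intro B hB
    refine ⟨fun t _ => good_avoid ℓ m hℓ hm 1 one_pos (one_dvd _) t (one_dvd _) B hB, ?_⟩
    simpa using good_avoid ℓ m hℓ hm (ℓ + m) (by omega) dvd_rfl 0 (dvd_zero _) B hB
end
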